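/- arXiv:1010.1961 — 2 statements merged into one kernel-verified Lean document; each statement's English description precedes it below -/
import Mathlib

section
/- Let ρ := inf{t ≥ 0 : M_t = M*_∞} be the (a.s. unique and a.s. finite) time at which M attains its overall maximum. Let S = (S_t)_{t ≥ 0} be a bounded real-valued adapted process with continuous sample paths such that the product process (M_t S_t)_{t ≥ 0} is a martingale with respect to (𝓕_t) and P. Then for all 0 ≤ s ≤ t, every event B ∈ 𝓕_s, and every bounded Borel function f : ℝ → ℝ, one has E[S_{ρ∧t} · f(1/M*_∞) · 1_B] = E[S_{ρ∧s} · f(1/M*_∞) · 1_B]. -/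
open MeasureTheory Filter Set
open scoped NNReal ENNReal

/-- The value of a continuous adapted process at a bounded stopping time is measurable with respect
to the σ-algebra of the stopping time. -/
lemma measurable_eval_stoppingTime {Ω : Type*} {m : MeasurableSpace Ω}
    {ℱ : Filtration ℝ≥0 m} {X : ℝ≥0 → Ω → ℝ} (hX : StronglyAdapted ℱ X)
    (hXc : ∀ ω, Continuous fun t => X t ω) {σ : Ω → ℝ≥0}
    (hσ : IsStoppingTime ℱ fun ω => (σ ω : WithTop ℝ≥0)) :
    Measurable[hσ.measurableSpace] fun ω => X (σ ω) ω :=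
  measurable_stoppedValue (hX.isStronglyProgressive_of_continuous hXc) hσ

/-- Approximation of `σ ∧ T` from above by values in a countable set. -/
noncomputable def gridAbove {Ω : Type*} (σ : Ω → ℝ≥0) (T : ℝ≥0) (n : ℕ) (ω : Ω) : ℝ≥0 :=
  min T (⌈σ ω * (n + 1)⌉₊ / (n + 1))

lemma isStoppingTime_gridAbove {Ω : Type*} {m : MeasurableSpace Ω}
    {ℱ : Filtration ℝ≥0 m} {σ : Ω → ℝ≥0}
    (hσ : IsStoppingTime ℱ fun ω => (σ ω : WithTop ℝ≥0)) (T : ℝ≥0) (n : ℕ) :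
    IsStoppingTime ℱ fun ω => (gridAbove σ T n ω : WithTop ℝ≥0) := by
  have hn : (0 : ℝ≥0) < n + 1 := by positivity
  intro u
  by_cases hu : T ≤ u
  · convert MeasurableSet.univ
    ext ω
    simp only [gridAbove, mem_ofPred_eq, WithTop.coe_le_coe, mem_univ, iff_true]
    exact (min_le_left _ _).trans hu
  · have h1 : (⌊u * (n + 1)⌋₊ / (n + 1) : ℝ≥0) ≤ u := by
      rw [div_le_iff₀ hn]
      exact Nat.floor_le (by positivity)
    convert ℱ.mono h1 _ (hσ (⌊u * (n + 1)⌋₊ / (n + 1))) using 1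
    ext ω
    simp only [gridAbove, mem_ofPred_eq, WithTop.coe_le_coe, min_le_iff, hu, false_or]
    rw [div_le_iff₀ hn, le_div_iff₀ hn, ← Nat.le_floor_iff (by positivity), Nat.ceil_le]

lemma le_gridAbove {Ω : Type*} {σ : Ω → ℝ≥0} {T : ℝ≥0} (hT : ∀ ω, σ ω ≤ T) (n : ℕ) (ω : Ω) :
    σ ω ≤ gridAbove σ T n ω := by
  have hn : (0 : ℝ≥0) < n + 1 := by positivity
  exact le_min (hT ω) ((le_div_iff₀ hn).2 (Nat.le_ceil _))

lemma tendsto_gridAbove {Ω : Type*} {σ : Ω → ℝ≥0} {T : ℝ≥0} (hT : ∀ ω, σ ω ≤ T) (ω : Ω) :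
    Tendsto (fun n => gridAbove σ T n ω) atTop (nhds (σ ω)) := by
  have h1 : Tendsto (fun n : ℕ => σ ω + 1 / ((n : ℝ≥0) + 1)) atTop (nhds (σ ω + 0)) :=
    tendsto_const_nhds.add tendsto_one_div_add_atTop_nhds_zero_nat
  rw [add_zero] at h1
  refine tendsto_of_tendsto_of_tendsto_of_le_of_le tendsto_const_nhds h1
    (fun n => le_gridAbove hT n ω) fun n => (min_le_right _ _).trans ?_
  have hn : (0 : ℝ≥0) < n + 1 := by positivity
  rw [div_le_iff₀ hn, add_mul, one_div, inv_mul_cancel₀ hn.ne']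
  exact (Nat.ceil_lt_add_one (by positivity)).le

lemma countable_range_gridAbove {Ω : Type*} (σ : Ω → ℝ≥0) (T : ℝ≥0) (n : ℕ) :
    (range fun ω => (gridAbove σ T n ω : WithTop ℝ≥0)).Countable := by
  refine (countable_range fun k : ℕ => ((min T (k / (n + 1)) : ℝ≥0) : WithTop ℝ≥0)).mono ?_
  rintro _ ⟨ω, rfl⟩
  exact ⟨⌈σ ω * (n + 1)⌉₊, rfl⟩

/-- **Optional sampling** for continuous martingales at a bounded stopping time. -/
theorem eval_ae_eq_condExp_of_le_const {Ω : Type*} {m : MeasurableSpace Ω} {P : Measure Ω}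
    [IsProbabilityMeasure P] {ℱ : Filtration ℝ≥0 m} {X : ℝ≥0 → Ω → ℝ} (hX : Martingale X ℱ P)
    (hXc : ∀ ω, Continuous fun t => X t ω) {σ : Ω → ℝ≥0}
    (hσ : IsStoppingTime ℱ fun ω => (σ ω : WithTop ℝ≥0)) {T : ℝ≥0} (hT : ∀ ω, σ ω ≤ T) :
    Integrable (fun ω => X (σ ω) ω) P ∧
      (fun ω => X (σ ω) ω) =ᵐ[P] P[X T | hσ.measurableSpace] := by
  have hst n := isStoppingTime_gridAbove hσ T n
  have hle n ω : (gridAbove σ T n ω : WithTop ℝ≥0) ≤ T := WithTop.coe_le_coe.2 (min_le_left _ _)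
  have hae n : (fun ω => X (gridAbove σ T n ω) ω) =ᵐ[P] P[X T | (hst n).measurableSpace] :=
    hX.stoppedValue_ae_eq_condExp_of_le_const_of_countable_range (hst n) (hle n)
      (countable_range_gridAbove σ T n)
  have hui : UniformIntegrable (fun n ω => X (gridAbove σ T n ω) ω) 1 P :=
    ((hX.integrable T).uniformIntegrable_condExp fun n => (hst n).measurableSpace_le).ae_eq
      fun n => (hae n).symm
  have hlim : ∀ᵐ ω ∂P, Tendsto (fun n => X (gridAbove σ T n ω) ω) atTop (nhds (X (σ ω) ω)) :=
    .of_forall fun ω => ((hXc ω).tendsto _).comp (tendsto_gridAbove hT ω)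
  have hmem : MemLp (fun ω => X (σ ω) ω) 1 P := hui.memLp_of_ae_tendsto hlim
  have hintg := memLp_one_iff_integrable.1 hmem
  refine ⟨hintg, ?_⟩
  refine ae_eq_condExp_of_forall_setIntegral_eq hσ.measurableSpace_le (hX.integrable T)
    (fun _ _ _ => hintg.integrableOn) (fun A hA _ => ?_)
    (measurable_eval_stoppingTime hX.1 hXc hσ).stronglyMeasurable.aestronglyMeasurable
  have hL1 := tendsto_Lp_finite_of_tendsto_ae le_rfl ENNReal.one_ne_top
    (fun n => hui.aestronglyMeasurable n) hmem hui.unifIntegrable hlim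
  have h1 := tendsto_setIntegral_of_L1' _ hintg.aestronglyMeasurable
    (.of_forall fun n => memLp_one_iff_integrable.1 (hui.memLp n)) hL1 A
  refine tendsto_nhds_unique h1 (tendsto_const_nhds.congr fun n => ?_)
  have hA' : MeasurableSet[(hst n).measurableSpace] A :=
    hσ.measurableSpace_mono (hst n) (fun ω => WithTop.coe_le_coe.2 (le_gridAbove hT n ω)) _ hA
  rw [← setIntegral_condExp (hst n).measurableSpace_le (hX.integrable T) hA']
  exact setIntegral_congr_ae ((hst n).measurableSpace_le _ hA')
    ((hae n).mono fun ω h _ => h.symm)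

/-- If `σ ≤ θ` are bounded stopping times and `S` is bounded, then `S_σ M_θ` and `M_r S_r`, for
`σ ≤ r`, have the same integral over events of the σ-algebra of `σ`. -/
theorem setIntegral_eval_mul_eval {Ω : Type*} {m : MeasurableSpace Ω} {P : Measure Ω}
    [IsProbabilityMeasure P] {ℱ : Filtration ℝ≥0 m} {M S : ℝ≥0 → Ω → ℝ} (hM : Martingale M ℱ P)
    (hMc : ∀ ω, Continuous fun t => M t ω) {C : ℝ} (hSbdd : ∀ t ω, |S t ω| ≤ C)
    (hSa : Adapted ℱ S) (hSc : ∀ ω, Continuous fun t => S t ω)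
    (hMS : Martingale (fun t ω => M t ω * S t ω) ℱ P) {σ θ : Ω → ℝ≥0}
    (hσ : IsStoppingTime ℱ fun ω => (σ ω : WithTop ℝ≥0))
    (hθ : IsStoppingTime ℱ fun ω => (θ ω : WithTop ℝ≥0)) (hσθ : ∀ ω, σ ω ≤ θ ω)
    {r T : ℝ≥0} (hr : ∀ ω, σ ω ≤ r) (hT : ∀ ω, θ ω ≤ T) {A : Set Ω}
    (hA : MeasurableSet[hσ.measurableSpace] A) :
    ∫ ω in A, S (σ ω) ω * M (θ ω) ω ∂P = ∫ ω in A, M r ω * S r ω ∂P := by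
  obtain ⟨hMθ, hMθ'⟩ := eval_ae_eq_condExp_of_le_const hM hMc hθ hT
  obtain ⟨-, hMσ'⟩ := eval_ae_eq_condExp_of_le_const hM hMc hσ fun ω => (hσθ ω).trans (hT ω)
  obtain ⟨-, hMSσ⟩ := eval_ae_eq_condExp_of_le_const hMS
    (fun ω => (hMc ω).mul (hSc ω)) hσ hr
  have hSm := (measurable_eval_stoppingTime (fun t => (hSa t).stronglyMeasurable) hSc hσ).stronglyMeasurable
  have hmono := hσ.measurableSpace_mono hθ fun ω => WithTop.coe_le_coe.2 (hσθ ω)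
  have hle := hσ.measurableSpace_le
  have hprod : Integrable ((fun ω => S (σ ω) ω) * fun ω => M (θ ω) ω) P :=
    hMθ.bdd_mul (hSm.mono hle).aestronglyMeasurable (.of_forall fun ω => hSbdd _ _)
  have h1 : P[(fun ω => S (σ ω) ω) * fun ω => M (θ ω) ω | hσ.measurableSpace] =ᵐ[P]
      P[fun ω => M r ω * S r ω | hσ.measurableSpace] := by
    have h2 : P[fun ω => M (θ ω) ω | hσ.measurableSpace] =ᵐ[P] fun ω => M (σ ω) ω :=
      ((condExp_congr_ae hMθ').trans
        (condExp_condExp_of_le hmono hθ.measurableSpace_le)).trans hMσ'.symm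
    refine (condExp_mul_of_stronglyMeasurable_left hSm hprod hMθ).trans ?_
    filter_upwards [h2, hMSσ] with ω h2 h3
    rw [← h3, Pi.mul_apply, h2, mul_comm]
  calc ∫ ω in A, S (σ ω) ω * M (θ ω) ω ∂P
      = ∫ ω in A, (P[(fun ω => S (σ ω) ω) * fun ω => M (θ ω) ω | hσ.measurableSpace]) ω ∂P :=
        (setIntegral_condExp hle hprod hA).symm
    _ = ∫ ω in A, (P[fun ω => M r ω * S r ω | hσ.measurableSpace]) ω ∂P :=
        setIntegral_congr_ae (hle _ hA) (h1.mono fun ω h _ => h)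
    _ = _ := setIntegral_condExp hle (hMS.integrable r) hA

/-- The first time, truncated at `r`, at which the process `M` reaches the level `a`. -/
noncomputable def levelHit {Ω : Type*} (M : ℝ≥0 → Ω → ℝ) (a : ℝ) (r : ℝ≥0) (ω : Ω) : ℝ≥0 :=
  sInf ({u | a ≤ M u ω} ∪ {r})

section levelHit

variable {Ω : Type*} {M : ℝ≥0 → Ω → ℝ} {a b : ℝ} {r s t u : ℝ≥0} {ω : Ω}

lemma levelHit_le : levelHit M a r ω ≤ r :=
  csInf_le (OrderBot.bddBelow _) (Or.inr rfl)

lemma levelHit_le_of_le (h : a ≤ M u ω) : levelHit M a r ω ≤ u :=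
  csInf_le (OrderBot.bddBelow _) (Or.inl h)

lemma lt_of_lt_levelHit (h : u < levelHit M a r ω) : M u ω < a :=
  not_le.1 fun h' => h.not_ge (levelHit_le_of_le h')

lemma le_or_levelHit_eq (hM : Continuous fun t => M t ω) :
    a ≤ M (levelHit M a r ω) ω ∨ levelHit M a r ω = r :=
  ((isClosed_le continuous_const hM).union isClosed_singleton).csInf_mem
    ⟨r, Or.inr rfl⟩ (OrderBot.bddBelow _)

lemma le_eval_levelHit (hM : Continuous fun t => M t ω) (h : levelHit M a r ω < r) :
    a ≤ M (levelHit M a r ω) ω :=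
  (le_or_levelHit_eq hM).resolve_right h.ne

lemma levelHit_mono (hM : Continuous fun t => M t ω) (hab : a ≤ b) (hrs : r ≤ s) :
    levelHit M a r ω ≤ levelHit M b s ω := by
  rcases le_or_levelHit_eq (a := b) (r := s) hM with h | h
  · exact levelHit_le_of_le (hab.trans h)
  · exact (levelHit_le.trans hrs).trans_eq h.symm

lemma levelHit_eq_of_lt (hM : Continuous fun t => M t ω) (hst : s ≤ t)
    (h : levelHit M a s ω < s) : levelHit M a t ω = levelHit M a s ω :=
  (levelHit_le_of_le (le_eval_levelHit hM h)).antisymm (levelHit_mono hM le_rfl hst)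

lemma eval_levelHit_le (hM : Continuous fun t => M t ω) (h0 : M 0 ω ≤ a) :
    M (levelHit M a r ω) ω ≤ a := by
  rcases eq_or_ne (levelHit M a r ω) 0 with h | h
  · rwa [h]
  · have : (nhdsWithin (levelHit M a r ω) (Iio (levelHit M a r ω))).NeBot :=
      nhdsLT_neBot_of_exists_lt ⟨0, pos_iff_ne_zero.2 h⟩
    have hev : ∀ᶠ u in nhdsWithin (levelHit M a r ω) (Iio (levelHit M a r ω)), M u ω ≤ a :=
      eventually_nhdsWithin_of_forall fun u hu => (lt_of_lt_levelHit hu).le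
    exact le_of_tendsto (hM.continuousAt.mono_left nhdsWithin_le_nhds) hev

lemma measurableSet_exists_le_le {m : MeasurableSpace Ω} {ℱ : Filtration ℝ≥0 m}
    (hM : StronglyAdapted ℱ M) (hMc : ∀ ω, Continuous fun t => M t ω) (a : ℝ) (u : ℝ≥0) :
    MeasurableSet[ℱ u] {ω | ∃ v ≤ u, a ≤ M v ω} := by
  obtain ⟨D, hDc, hD⟩ := TopologicalSpace.exists_countable_dense ℝ≥0
  have : Countable D := hDc.to_subtype
  have hmeas : Measurable[ℱ u] fun ω => ⨆ q : D, M (min q u) ω :=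
    Measurable.iSup fun q => ((hM _).mono (ℱ.mono (min_le_right _ _))).measurable
  convert measurableSet_le (measurable_const (a := a)) hmeas using 1
  ext ω
  have hc : Continuous fun v => M (min v u) ω := (hMc ω).comp (continuous_id.min continuous_const)
  have himg : range (fun v => M (min v u) ω) = (fun v => M v ω) '' Icc 0 u := by
    ext x
    constructor
    · rintro ⟨v, rfl⟩
      exact ⟨min v u, ⟨zero_le, min_le_right _ _⟩, rfl⟩
    · rintro ⟨v, hv, rfl⟩
      exact ⟨v, by simp [min_eq_left hv.2]⟩
  have hcpt : IsCompact (range fun v => M (min v u) ω) :=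
    himg ▸ isCompact_Icc.image (hMc ω)
  rw [mem_ofPred_eq, mem_ofPred_eq, hD.ciSup' hc]
  constructor
  · rintro ⟨v, hv, h⟩
    refine h.trans ?_
    simpa [min_eq_left hv] using le_ciSup hcpt.bddAbove v
  · intro h
    obtain ⟨v, hv⟩ := hcpt.sSup_mem (range_nonempty _)
    exact ⟨min v u, min_le_right _ _, h.trans_eq hv.symm⟩

lemma isStoppingTime_levelHit {m : MeasurableSpace Ω} {ℱ : Filtration ℝ≥0 m}
    (hM : StronglyAdapted ℱ M) (hMc : ∀ ω, Continuous fun t => M t ω) (a : ℝ) (r : ℝ≥0) :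
    IsStoppingTime ℱ fun ω => (levelHit M a r ω : WithTop ℝ≥0) := by
  intro u
  by_cases hu : r ≤ u
  · convert MeasurableSet.univ
    ext ω
    simp only [mem_ofPred_eq, WithTop.coe_le_coe, mem_univ, iff_true]
    exact levelHit_le.trans hu
  · convert measurableSet_exists_le_le hM hMc a u using 1
    ext ω
    simp only [mem_ofPred_eq, WithTop.coe_le_coe]
    refine ⟨fun h => ⟨_, h, le_eval_levelHit (hMc ω) (h.trans_lt (not_le.1 hu))⟩, ?_⟩
    rintro ⟨v, hv, h⟩
    exact (levelHit_le_of_le h).trans hv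

lemma measurable_eval_levelHit {m : MeasurableSpace Ω} {ℱ : Filtration ℝ≥0 m}
    {X : ℝ≥0 → Ω → ℝ} (hX : StronglyAdapted ℱ X) (hXc : ∀ ω, Continuous fun t => X t ω)
    (hM : StronglyAdapted ℱ M) (hMc : ∀ ω, Continuous fun t => M t ω) (a : ℝ) (r : ℝ≥0) :
    Measurable fun ω => X (levelHit M a r ω) ω :=
  (measurable_eval_stoppingTime hX hXc (isStoppingTime_levelHit hM hMc a r)).mono
    (isStoppingTime_levelHit hM hMc a r).measurableSpace_le le_rfl

lemma measurable_iSup_of_continuous {m : MeasurableSpace Ω} (hM : ∀ t, Measurable (M t))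
    (hMc : ∀ ω, Continuous fun t => M t ω) : Measurable fun ω => ⨆ v, M v ω := by
  obtain ⟨D, hDc, hD⟩ := TopologicalSpace.exists_countable_dense ℝ≥0
  have : Countable D := hDc.to_subtype
  simp_rw [← fun ω => hD.ciSup' (hMc ω)]
  exact Measurable.iSup fun q => hM q

/-- Before the level `a ≤ b` is reached, the product of `S` with the martingale stopped at level
`b` has no drift. -/
lemma setIntegral_levelHit_mul_eq {m : MeasurableSpace Ω} {P : Measure Ω}
    [IsProbabilityMeasure P] {ℱ : Filtration ℝ≥0 m} {S : ℝ≥0 → Ω → ℝ} (hM : Martingale M ℱ P)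
    (hMc : ∀ ω, Continuous fun t => M t ω) {C : ℝ} (hSbdd : ∀ t ω, |S t ω| ≤ C)
    (hSa : Adapted ℱ S) (hSc : ∀ ω, Continuous fun t => S t ω)
    (hMS : Martingale (fun t ω => M t ω * S t ω) ℱ P) (hab : a ≤ b) {T : ℝ≥0}
    (hst : s ≤ t) (htT : t ≤ T) {B : Set Ω} (hB : MeasurableSet[ℱ s] B) :
    ∫ ω in B, (S (levelHit M a t ω) ω - S (levelHit M a s ω) ω) * M (levelHit M b T ω) ω ∂P
      = 0 := by
  have hτ := isStoppingTime_levelHit hM.1 hMc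
  have hSa' : StronglyAdapted ℱ S := fun t => (hSa t).stronglyMeasurable
  set A : Set Ω := {ω | (s : WithTop ℝ≥0) ≤ levelHit M a s ω} with hAdef
  have hAs : MeasurableSet[ℱ s] A := (hτ a s).measurableSet_ge s
  have hσ : MeasurableSet[(hτ a s).measurableSpace] (B ∩ A) := by
    refine ⟨le_iSup (fun t => ℱ t) s _ (hB.inter hAs), fun u => ?_⟩
    by_cases hu : s ≤ u
    · exact (ℱ.mono hu _ (hB.inter hAs)).inter ((hτ a s) u)
    · convert MeasurableSet.empty
      ext ω
      simp only [mem_inter_iff, mem_ofPred_eq, mem_empty_iff_false, iff_false, not_and, not_le]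
      exact fun h => lt_of_lt_of_le (WithTop.coe_lt_coe.2 (not_le.1 hu)) h.2
  have hσ' : MeasurableSet[(hτ a t).measurableSpace] (B ∩ A) :=
    (hτ a s).measurableSpace_mono (hτ a t)
      (fun ω => WithTop.coe_le_coe.2 (levelHit_mono (hMc ω) le_rfl hst)) _ hσ
  have hθint := (eval_ae_eq_condExp_of_le_const hM hMc (hτ b T) fun ω => levelHit_le).1
  have hintg r : Integrable (fun ω => S (levelHit M a r ω) ω * M (levelHit M b T ω) ω) P :=
    hθint.bdd_mul (measurable_eval_levelHit hSa' hSc hM.1 hMc a r).aestronglyMeasurable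
      (.of_forall fun ω => hSbdd _ _)
  have hBm := ℱ.le s _ hB
  have hAm := ℱ.le s _ hAs
  rw [← integral_inter_add_sdiff hAm]
  · have h1 : ∫ ω in B \ A, (S (levelHit M a t ω) ω - S (levelHit M a s ω) ω)
        * M (levelHit M b T ω) ω ∂P = 0 := by
      refine setIntegral_eq_zero_of_forall_eq_zero fun ω hω => ?_
      have : levelHit M a s ω < s := WithTop.coe_lt_coe.1 (not_le.1 hω.2)
      rw [levelHit_eq_of_lt (hMc ω) hst this, sub_self, zero_mul]
    rw [h1, add_zero]
    simp_rw [sub_mul]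
    rw [integral_sub (hintg t).integrableOn (hintg s).integrableOn,
      setIntegral_eval_mul_eval hM hMc hSbdd hSa hSc hMS (hτ a t) (hτ b T)
        (fun ω => levelHit_mono (hMc ω) hab htT) (fun ω => levelHit_le) (fun ω => levelHit_le) hσ',
      setIntegral_eval_mul_eval hM hMc hSbdd hSa hSc hMS (hτ a s) (hτ b T)
        (fun ω => levelHit_mono (hMc ω) hab (hst.trans htT)) (fun ω => levelHit_le.trans hst)
        (fun ω => levelHit_le) hσ, sub_self]
  · simp_rw [sub_mul]
    exact ((hintg t).sub (hintg s)).integrableOn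

lemma exists_forall_le_of_tendsto_zero (hM : Continuous fun t => M t ω) (h0 : M 0 ω = 1)
    (hlim : Tendsto (fun t => M t ω) atTop (nhds 0)) : ∃ v, ∀ u, M u ω ≤ M v ω := by
  refine hM.exists_forall_ge' 0 ?_
  rw [cocompact_eq_atTop, h0]
  exact (hlim.eventually_lt_const one_pos).mono fun _ h => h.le

lemma tendsto_eval_levelHit (hM : Continuous fun t => M t ω) (h0 : M 0 ω = 1)
    (hlim : Tendsto (fun t => M t ω) atTop (nhds 0)) (hb : 1 ≤ b) :
    Tendsto (fun n : ℕ => M (levelHit M b n ω) ω) atTop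
      (nhds ({ω | b ≤ ⨆ v, M v ω}.indicator (fun _ => b) ω)) := by
  obtain ⟨v, hv⟩ := exists_forall_le_of_tendsto_zero hM h0 hlim
  have hsup : ⨆ v, M v ω = M v ω :=
    le_antisymm (ciSup_le hv) (le_ciSup (f := fun v => M v ω) ⟨_, forall_mem_range.2 hv⟩ v)
  have hcast : Tendsto (fun n : ℕ => (n : ℝ≥0)) atTop atTop := tendsto_natCast_atTop_atTop
  by_cases h : b ≤ M v ω
  · rw [indicator_of_mem (by rwa [mem_ofPred_eq, hsup])]
    refine tendsto_const_nhds.congr' ?_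
    filter_upwards [hcast.eventually_gt_atTop v] with n hn
    exact (le_eval_levelHit hM ((levelHit_le_of_le h).trans_lt hn)).antisymm
      (eval_levelHit_le hM (h0.trans_le hb))
  · rw [indicator_of_notMem (by rwa [mem_ofPred_eq, hsup])]
    refine (hlim.comp hcast).congr fun n => ?_
    have : levelHit M b n ω = n :=
      (le_or_levelHit_eq hM).resolve_left fun h' => h (h'.trans (hv _))
    rw [this, Function.comp]

/-- The increments of `S` stopped at level `a` are orthogonal to the event that the overall
maximum exceeds a level `b ≥ a`. -/
lemma setIntegral_levelHit_sub_eq_zero {m : MeasurableSpace Ω} {P : Measure Ω}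
    [IsProbabilityMeasure P] {ℱ : Filtration ℝ≥0 m} {S : ℝ≥0 → Ω → ℝ} (hM : Martingale M ℱ P)
    (hMnonneg : ∀ t ω, 0 ≤ M t ω) (hMc : ∀ ω, Continuous fun t => M t ω)
    (hM0 : ∀ᵐ ω ∂P, M 0 ω = 1)
    (hMlim : ∀ᵐ ω ∂P, Tendsto (fun t => M t ω) atTop (nhds (0 : ℝ)))
    {C : ℝ} (hSbdd : ∀ t ω, |S t ω| ≤ C)
    (hSa : Adapted ℱ S) (hSc : ∀ ω, Continuous fun t => S t ω)
    (hMS : Martingale (fun t ω => M t ω * S t ω) ℱ P) (hb : 1 ≤ b) (hab : a ≤ b)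
    (hst : s ≤ t) {B : Set Ω} (hB : MeasurableSet[ℱ s] B) :
    ∫ ω in B ∩ {ω | b ≤ ⨆ v, M v ω}, (S (levelHit M a t ω) ω - S (levelHit M a s ω) ω) ∂P
      = 0 := by
  have hSa' : StronglyAdapted ℱ S := fun t => (hSa t).stronglyMeasurable
  have hMm : MeasurableSet {ω | b ≤ ⨆ v, M v ω} := measurableSet_le measurable_const
    (measurable_iSup_of_continuous (fun t => ((hM.1 t).mono (ℱ.le t)).measurable) hMc)
  set D : Ω → ℝ := fun ω => S (levelHit M a t ω) ω - S (levelHit M a s ω) ω with hD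
  have hDm : Measurable D := (measurable_eval_levelHit hSa' hSc hM.1 hMc a t).sub
    (measurable_eval_levelHit hSa' hSc hM.1 hMc a s)
  have hDbdd ω : |D ω| ≤ C + C := (abs_sub _ _).trans (add_le_add (hSbdd _ _) (hSbdd _ _))
  have hlim : Tendsto (fun n : ℕ => ∫ ω in B, D ω * M (levelHit M b n ω) ω ∂P) atTop
      (nhds (∫ ω in B, D ω * {ω | b ≤ ⨆ v, M v ω}.indicator (fun _ => b) ω ∂P)) := by
    refine tendsto_integral_of_dominated_convergence (fun _ => (C + C) * b)
      (fun n => (hDm.mul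
        (measurable_eval_levelHit hM.1 hMc hM.1 hMc b n)).aestronglyMeasurable)
      (integrable_const _) (fun n => ae_restrict_of_ae ?_) (ae_restrict_of_ae ?_)
    · filter_upwards [hM0] with ω h0
      rw [Real.norm_eq_abs, abs_mul, abs_of_nonneg (hMnonneg _ _)]
      exact mul_le_mul (hDbdd ω) (eval_levelHit_le (hMc ω) (h0.trans_le hb)) (hMnonneg _ _)
        ((abs_nonneg _).trans (hDbdd ω))
    · filter_upwards [hM0, hMlim] with ω h0 hl
      exact (tendsto_eval_levelHit (hMc ω) h0 hl hb).const_mul _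
  have hzero : ∫ ω in B, D ω * {ω | b ≤ ⨆ v, M v ω}.indicator (fun _ => b) ω ∂P = 0 := by
    refine tendsto_nhds_unique hlim (tendsto_const_nhds.congr' ?_)
    filter_upwards [tendsto_natCast_atTop_atTop.eventually_ge_atTop t] with n hn
    exact (setIntegral_levelHit_mul_eq hM hMc hSbdd hSa hSc hMS hab hst hn hB).symm
  have heq : (fun ω => D ω * {ω | b ≤ ⨆ v, M v ω}.indicator (fun _ => b) ω)
      = {ω | b ≤ ⨆ v, M v ω}.indicator fun ω => D ω * b := by
    ext ω
    by_cases h : ω ∈ {ω | b ≤ ⨆ v, M v ω} <;> simp [h]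
  rw [heq, setIntegral_indicator hMm, integral_mul_const] at hzero
  exact (mul_eq_zero.1 hzero).resolve_right (one_pos.trans_le hb).ne'

/-- If the levels `a n` increase to the overall maximum, the times at which they are reached
approach the first time of the maximum. -/
lemma tendsto_levelHit_of_isMax (hM : Continuous fun t => M t ω) {v : ℝ≥0}
    (hlt : ∀ u < v, M u ω < M v ω) {l : ℕ → ℝ} (hl : ∀ n, l n ≤ M v ω)
    (hlim : Tendsto l atTop (nhds (M v ω))) (r : ℝ≥0) :
    Tendsto (fun n => levelHit M (l n) r ω) atTop (nhds (min v r)) := by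
  refine tendsto_order.2 ⟨fun u hu => ?_, fun u hu => .of_forall fun n =>
    (le_min (levelHit_le_of_le (hl n)) levelHit_le).trans_lt hu⟩
  obtain ⟨w, hw, hmax⟩ := isCompact_Icc.exists_isMaxOn (nonempty_Icc.2 (zero_le (a := u)))
    hM.continuousOn
  have hwv : M w ω < M v ω := hlt w (hw.2.trans_lt (hu.trans_le (min_le_left _ _)))
  filter_upwards [hlim.eventually_const_lt hwv] with n hn
  by_contra! hle
  have h1 := hmax (show levelHit M (l n) r ω ∈ Icc 0 u from ⟨zero_le, hle⟩)
  exact (hn.trans_le (le_eval_levelHit hM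
    (hle.trans_lt (hu.trans_le (min_le_right _ _))))).not_ge h1

end levelHit

/-- The largest point of the grid `c, c + 1 / (n + 1), c + 2 / (n + 1), …` below `x`, as an index. -/
noncomputable def gridIndex (c x : ℝ) (n : ℕ) : ℕ := ⌊(x - c) * (n + 1)⌋₊

lemma gridIndex_eq_iff {c x : ℝ} (hcx : c ≤ x) (n k : ℕ) :
    gridIndex c x n = k ↔ c + k / (n + 1) ≤ x ∧ ¬ c + (k + 1 : ℕ) / (n + 1) ≤ x := by
  have hn : (0 : ℝ) < n + 1 := by positivity
  rw [gridIndex, Nat.floor_eq_iff (mul_nonneg (sub_nonneg.2 hcx) hn.le), ← le_sub_iff_add_le',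
    ← le_sub_iff_add_le', div_le_iff₀ hn, div_le_iff₀ hn, not_le, Nat.cast_add_one]

lemma grid_le {c x : ℝ} (hcx : c ≤ x) (n : ℕ) : c + gridIndex c x n / (n + 1) ≤ x :=
  ((gridIndex_eq_iff hcx n _).1 rfl).1

lemma tendsto_grid {c x : ℝ} (hcx : c ≤ x) :
    Tendsto (fun n : ℕ => c + gridIndex c x n / (n + 1)) atTop (nhds x) := by
  have h1 : Tendsto (fun n : ℕ => x - 1 / ((n : ℝ) + 1)) atTop (nhds (x - 0)) :=
    tendsto_const_nhds.sub tendsto_one_div_add_atTop_nhds_zero_nat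
  rw [sub_zero] at h1
  refine tendsto_of_tendsto_of_tendsto_of_le_of_le h1 tendsto_const_nhds (fun n => ?_)
    fun n => grid_le hcx n
  have h2 := ((gridIndex_eq_iff hcx n _).1 rfl).2
  rw [Nat.cast_add_one, add_div] at h2
  dsimp only
  linarith

section firstArgmax

variable {Ω : Type*} {M : ℝ≥0 → Ω → ℝ}

/-- The first time at which the running process attains its overall supremum is a strict first
maximizer. -/
lemma eval_sInf_eq_iSup {ω : Ω} (hM : Continuous fun t => M t ω) (h0 : M 0 ω = 1)
    (hlim : Tendsto (fun t => M t ω) atTop (nhds 0)) {v : ℝ≥0}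
    (hv : v = sInf {u : ℝ≥0 | M u ω = ⨆ v, M v ω}) :
    M v ω = ⨆ v, M v ω ∧ 1 ≤ M v ω ∧ ∀ u < v, M u ω < M v ω := by
  obtain ⟨w, hw⟩ := exists_forall_le_of_tendsto_zero hM h0 hlim
  have hbdd : BddAbove (range fun v => M v ω) := ⟨_, forall_mem_range.2 hw⟩
  have hmem : M v ω = ⨆ v, M v ω := by
    have := (isClosed_eq hM (continuous_const (y := ⨆ v, M v ω))).csInf_mem
      ⟨w, le_antisymm (le_ciSup hbdd w) (ciSup_le hw)⟩ (OrderBot.bddBelow _)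
    rwa [← hv] at this
  refine ⟨hmem, h0.symm.le.trans ((le_ciSup hbdd 0).trans_eq hmem.symm), fun u hu => ?_⟩
  refine lt_of_le_of_ne ((le_ciSup hbdd u).trans_eq hmem.symm) fun h => hu.not_ge ?_
  rw [hv]
  exact csInf_le (OrderBot.bddBelow _) (h.trans hmem)

/-- The value of `S` at the time `levelHit M a r`, where the level `a` is the largest point of the
`n`-th grid below the overall supremum of `M`. -/
noncomputable def evalGridHit (M S : ℝ≥0 → Ω → ℝ) (c : ℝ) (r : ℝ≥0) (n : ℕ) (ω : Ω) : ℝ :=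
  S (levelHit M (c + gridIndex c (⨆ v, M v ω) n / (n + 1)) r ω) ω

lemma measurable_evalGridHit {m : MeasurableSpace Ω} {ℱ : Filtration ℝ≥0 m} {S : ℝ≥0 → Ω → ℝ}
    (hM : StronglyAdapted ℱ M) (hMc : ∀ ω, Continuous fun t => M t ω)
    (hS : StronglyAdapted ℱ S) (hSc : ∀ ω, Continuous fun t => S t ω) (c : ℝ) (r : ℝ≥0) (n : ℕ) :
    Measurable (evalGridHit M S c r n) := by
  have hsup : Measurable fun ω => ⨆ v, M v ω :=
    measurable_iSup_of_continuous (fun t => ((hM t).mono (ℱ.le t)).measurable) hMc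
  have hidx : Measurable fun ω => gridIndex c (⨆ v, M v ω) n :=
    Nat.measurable_floor.comp ((hsup.sub_const c).mul_const _)
  let F (p : ℕ × Ω) : ℝ := S (levelHit M (c + (p.1 : ℝ) / (n + 1)) r p.2) p.2
  have hF : Measurable F := by
    refine measurable_from_prod_countable_right fun k => ?_
    exact measurable_eval_levelHit hS hSc hM hMc (c + (k : ℝ) / (n + 1)) r
  have hcomp : Measurable fun ω => F (gridIndex c (⨆ v, M v ω) n, ω) :=
    hF.comp (hidx.prodMk measurable_id)
  exact hcomp

lemma tendsto_evalGridHit {S : ℝ≥0 → Ω → ℝ} {ω : Ω} (hM : Continuous fun t => M t ω)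
    (h0 : M 0 ω = 1) (hlim : Tendsto (fun t => M t ω) atTop (nhds 0))
    (hS : Continuous fun t => S t ω) {v : ℝ≥0}
    (hv : v = sInf {u : ℝ≥0 | M u ω = ⨆ v, M v ω}) {c : ℝ} (hc : c ≤ ⨆ v, M v ω) (r : ℝ≥0) :
    Tendsto (fun n => evalGridHit M S c r n ω) atTop (nhds (S (min v r) ω)) := by
  obtain ⟨h1, -, h2⟩ := eval_sInf_eq_iSup hM h0 hlim hv
  refine (hS.tendsto _).comp (tendsto_levelHit_of_isMax hM h2 (fun n => ?_) ?_ r)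
  · exact (grid_le hc n).trans_eq h1.symm
  · exact (tendsto_grid hc).mono_right (congrArg nhds h1.symm).le

variable {m : MeasurableSpace Ω} {P : Measure Ω} {ℱ : Filtration ℝ≥0 m}
  {S : ℝ≥0 → Ω → ℝ} {ρ : Ω → ℝ≥0}

lemma aestronglyMeasurable_eval_firstArgmax (hM : StronglyAdapted ℱ M)
    (hMc : ∀ ω, Continuous fun t => M t ω) (hM0 : ∀ᵐ ω ∂P, M 0 ω = 1)
    (hMlim : ∀ᵐ ω ∂P, Tendsto (fun t => M t ω) atTop (nhds (0 : ℝ)))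
    (hρ : ∀ ω, ρ ω = sInf {u : ℝ≥0 | M u ω = ⨆ v, M v ω})
    (hS : StronglyAdapted ℱ S) (hSc : ∀ ω, Continuous fun t => S t ω) (r : ℝ≥0) :
    AEStronglyMeasurable (fun ω => S (min (ρ ω) r) ω) P := by
  refine aestronglyMeasurable_of_tendsto_ae atTop
    (fun n => (measurable_evalGridHit hM hMc hS hSc 1 r n).aestronglyMeasurable) ?_
  filter_upwards [hM0, hMlim] with ω h0 hl
  obtain ⟨h1, h2, -⟩ := eval_sInf_eq_iSup (hMc ω) h0 hl (hρ ω)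
  exact tendsto_evalGridHit (hMc ω) h0 hl (hSc ω) (hρ ω) (h2.trans_eq h1) r

lemma setIntegral_evalGridHit_sub_eq_zero [IsProbabilityMeasure P] (hM : Martingale M ℱ P)
    (hMnonneg : ∀ t ω, 0 ≤ M t ω) (hMc : ∀ ω, Continuous fun t => M t ω)
    (hM0 : ∀ᵐ ω ∂P, M 0 ω = 1)
    (hMlim : ∀ᵐ ω ∂P, Tendsto (fun t => M t ω) atTop (nhds (0 : ℝ)))
    {C : ℝ} (hSbdd : ∀ t ω, |S t ω| ≤ C)
    (hSa : Adapted ℱ S) (hSc : ∀ ω, Continuous fun t => S t ω)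
    (hMS : Martingale (fun t ω => M t ω * S t ω) ℱ P) {c : ℝ} (hc : 1 ≤ c) {s t : ℝ≥0}
    (hst : s ≤ t) {B : Set Ω} (hB : MeasurableSet[ℱ s] B) (n : ℕ) :
    ∫ ω in B ∩ {ω | c ≤ ⨆ v, M v ω}, (evalGridHit M S c t n ω - evalGridHit M S c s n ω) ∂P
      = 0 := by
  have hSa' : StronglyAdapted ℱ S := fun t => (hSa t).stronglyMeasurable
  have hsup : Measurable fun ω => ⨆ v, M v ω :=
    measurable_iSup_of_continuous (fun t => ((hM.1 t).mono (ℱ.le t)).measurable) hMc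
  have hidx : Measurable fun ω => gridIndex c (⨆ v, M v ω) n :=
    Nat.measurable_floor.comp ((hsup.sub_const c).mul_const _)
  have hge (b : ℝ) : MeasurableSet (B ∩ {ω | b ≤ ⨆ v, M v ω}) :=
    (ℱ.le s _ hB).inter (measurableSet_le measurable_const hsup)
  have hintg r : Integrable (evalGridHit M S c r n) P :=
    .of_bound (measurable_evalGridHit hM.1 hMc hSa' hSc c r n).aestronglyMeasurable C
      (.of_forall fun ω => hSbdd _ _)
  have hintg' a r : Integrable (fun ω => S (levelHit M a r ω) ω) P :=
    .of_bound (measurable_eval_levelHit hSa' hSc hM.1 hMc a r).aestronglyMeasurable C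
      (.of_forall fun ω => hSbdd _ _)
  have hdiff a : Integrable (fun ω => S (levelHit M a t ω) ω - S (levelHit M a s ω) ω) P :=
    (hintg' a t).sub (hintg' a s)
  set E : ℕ → Set Ω := fun k => B ∩ {ω | c ≤ ⨆ v, M v ω} ∩ {ω | gridIndex c (⨆ v, M v ω) n = k}
  have hE : ⋃ k, E k = B ∩ {ω | c ≤ ⨆ v, M v ω} := by
    ext ω
    simp [E]
  have hEm k : MeasurableSet (E k) := (hge c).inter (hidx (measurableSet_singleton k))
  have hEd : Pairwise (Function.onFun Disjoint E) := fun i j hij =>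
    disjoint_left.2 fun ω hi hj => hij (hi.2.symm.trans hj.2)
  have hsum := hasSum_integral_iUnion hEm hEd
    (((hintg t).sub (hintg s)).integrableOn (s := ⋃ k, E k))
  rw [hE] at hsum
  have hpiece k : ∫ ω in E k, (evalGridHit M S c t n - evalGridHit M S c s n) ω ∂P = 0 := by
    have hck : c ≤ c + k / (n + 1) := le_add_of_nonneg_right (by positivity)
    have hckk : c + (k : ℝ) / (n + 1) ≤ c + (k + 1 : ℕ) / (n + 1) := by
      push_cast
      gcongr
      linarith
    have hEk : E k = (B ∩ {ω | c + k / (n + 1) ≤ ⨆ v, M v ω}) \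
        (B ∩ {ω | c + (k + 1 : ℕ) / (n + 1) ≤ ⨆ v, M v ω}) := by
      ext ω
      constructor
      · rintro ⟨⟨h1, h2⟩, h3⟩
        have := (gridIndex_eq_iff h2 n k).1 h3
        exact ⟨⟨h1, this.1⟩, fun h => this.2 h.2⟩
      · rintro ⟨⟨h1, h2⟩, h3⟩
        have hc' : c ≤ ⨆ v, M v ω := hck.trans h2
        exact ⟨⟨h1, hc'⟩, (gridIndex_eq_iff hc' n k).2 ⟨h2, fun h => h3 ⟨h1, h⟩⟩⟩
    have hcongr : ∫ ω in E k, (evalGridHit M S c t n - evalGridHit M S c s n) ω ∂P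
        = ∫ ω in E k, (S (levelHit M (c + k / (n + 1)) t ω) ω
            - S (levelHit M (c + k / (n + 1)) s ω) ω) ∂P := by
      refine setIntegral_congr_fun (hEm k) fun ω hω => ?_
      have hk : gridIndex c (⨆ v, M v ω) n = k := hω.2
      simp only [Pi.sub_apply, evalGridHit, hk]
    have hzero {b : ℝ} (hb : c + k / (n + 1) ≤ b) :=
      setIntegral_levelHit_sub_eq_zero hM hMnonneg hMc hM0 hMlim hSbdd hSa hSc hMS
        (hc.trans (hck.trans hb)) hb hst hB
    have hsub : B ∩ {ω | c + (k + 1 : ℕ) / (n + 1) ≤ ⨆ v, M v ω}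
        ⊆ B ∩ {ω | c + k / (n + 1) ≤ ⨆ v, M v ω} := fun ω h => ⟨h.1, hckk.trans h.2⟩
    rw [hcongr, hEk, setIntegral_sdiff (hge _) (hdiff _).integrableOn hsub, hzero le_rfl,
      hzero hckk, sub_zero]
  exact hsum.unique (by simpa only [hpiece] using hasSum_zero)

lemma setIntegral_eval_firstArgmax_eq [IsProbabilityMeasure P] (hM : Martingale M ℱ P)
    (hMnonneg : ∀ t ω, 0 ≤ M t ω) (hMc : ∀ ω, Continuous fun t => M t ω)
    (hM0 : ∀ᵐ ω ∂P, M 0 ω = 1)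
    (hMlim : ∀ᵐ ω ∂P, Tendsto (fun t => M t ω) atTop (nhds (0 : ℝ)))
    (hρ : ∀ ω, ρ ω = sInf {u : ℝ≥0 | M u ω = ⨆ v, M v ω})
    {C : ℝ} (hSbdd : ∀ t ω, |S t ω| ≤ C)
    (hSa : Adapted ℱ S) (hSc : ∀ ω, Continuous fun t => S t ω)
    (hMS : Martingale (fun t ω => M t ω * S t ω) ℱ P) (c : ℝ) {s t : ℝ≥0}
    (hst : s ≤ t) {B : Set Ω} (hB : MeasurableSet[ℱ s] B) :
    ∫ ω in B ∩ {ω | c ≤ ⨆ v, M v ω}, S (min (ρ ω) t) ω ∂P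
      = ∫ ω in B ∩ {ω | c ≤ ⨆ v, M v ω}, S (min (ρ ω) s) ω ∂P := by
  wlog hc : 1 ≤ c generalizing c
  · have hset : (B ∩ {ω | c ≤ ⨆ v, M v ω} : Set Ω) =ᵐ[P]
        (B ∩ {ω | 1 ≤ ⨆ v, M v ω} : Set Ω) := by
      filter_upwards [hM0, hMlim] with ω h0 hl
      obtain ⟨h1, h2, -⟩ := eval_sInf_eq_iSup (hMc ω) h0 hl (hρ ω)
      have h3 : 1 ≤ ⨆ v, M v ω := h2.trans_eq h1
      exact propext (and_congr_right fun _ =>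
        ⟨fun _ => h3, fun _ => (not_le.1 hc).le.trans h3⟩)
    rw [setIntegral_congr_set hset, setIntegral_congr_set hset]
    exact this 1 le_rfl
  have hSa' : StronglyAdapted ℱ S := fun t => (hSa t).stronglyMeasurable
  have hsup : Measurable fun ω => ⨆ v, M v ω :=
    measurable_iSup_of_continuous (fun t => ((hM.1 t).mono (ℱ.le t)).measurable) hMc
  have hAm : MeasurableSet (B ∩ {ω | c ≤ ⨆ v, M v ω}) :=
    (ℱ.le s _ hB).inter (measurableSet_le measurable_const hsup)
  have hlim r : Tendsto (fun n => ∫ ω in B ∩ {ω | c ≤ ⨆ v, M v ω}, evalGridHit M S c r n ω ∂P)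
      atTop (nhds (∫ ω in B ∩ {ω | c ≤ ⨆ v, M v ω}, S (min (ρ ω) r) ω ∂P)) := by
    refine tendsto_integral_of_dominated_convergence (fun _ => C)
      (fun n => (measurable_evalGridHit hM.1 hMc hSa' hSc c r n).aestronglyMeasurable)
      (integrable_const _) (fun n => .of_forall fun ω => hSbdd _ _) ?_
    rw [ae_restrict_iff' hAm]
    filter_upwards [hM0, hMlim] with ω h0 hl hω
    exact tendsto_evalGridHit (hMc ω) h0 hl (hSc ω) (hρ ω) hω.2 r
  have hintg r n : Integrable (evalGridHit M S c r n) P :=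
    .of_bound (measurable_evalGridHit hM.1 hMc hSa' hSc c r n).aestronglyMeasurable C
      (.of_forall fun ω => hSbdd _ _)
  refine tendsto_nhds_unique (hlim t) ((hlim s).congr fun n => ?_)
  rw [eq_comm, ← sub_eq_zero, ← integral_sub (hintg t n).integrableOn (hintg s n).integrableOn]
  exact setIntegral_evalGridHit_sub_eq_zero hM hMnonneg hMc hM0 hMlim hSbdd hSa hSc hMS hc hst hB n

end firstArgmax

/-- If two bounded functions have the same integral over all events `{b ≤ Z}`, they have the same
integral against every measurable function of `Z`. -/
lemma integral_mul_comp_eq_of_setIntegral_le_eq {Ω : Type*} {m : MeasurableSpace Ω}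
    {μ : Measure Ω} [IsFiniteMeasure μ] {Y₁ Y₂ Z : Ω → ℝ} {C : ℝ}
    (h₁ : AEStronglyMeasurable Y₁ μ) (h₂ : AEStronglyMeasurable Y₂ μ) (hZ : Measurable Z)
    (hb₁ : ∀ ω, |Y₁ ω| ≤ C) (hb₂ : ∀ ω, |Y₂ ω| ≤ C)
    (h : ∀ b, ∫ ω in {ω | b ≤ Z ω}, Y₁ ω ∂μ = ∫ ω in {ω | b ≤ Z ω}, Y₂ ω ∂μ)
    {g : ℝ → ℝ} (hg : Measurable g) {K : ℝ} (hgb : ∀ x, |g x| ≤ K) :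
    ∫ ω, Y₁ ω * g (Z ω) ∂μ = ∫ ω, Y₂ ω * g (Z ω) ∂μ := by
  let ν (Y : Ω → ℝ) : Measure ℝ := (μ.withDensity fun ω => ENNReal.ofReal (C + Y ω)).map Z
  have hintg {Y : Ω → ℝ} (hY : AEStronglyMeasurable Y μ) (hb : ∀ ω, |Y ω| ≤ C) : Integrable Y μ :=
    .of_bound hY C (.of_forall hb)
  have hnn {Y : Ω → ℝ} (hb : ∀ ω, |Y ω| ≤ C) ω : 0 ≤ C + Y ω := by
    linarith [neg_le_of_abs_le (hb ω)]
  have hIci {Y : Ω → ℝ} (hY : AEStronglyMeasurable Y μ) (hb : ∀ ω, |Y ω| ≤ C) (b : ℝ) :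
      ν Y (Ici b) = ENNReal.ofReal (∫ ω in {ω | b ≤ Z ω}, C ∂μ + ∫ ω in {ω | b ≤ Z ω}, Y ω ∂μ) := by
    have hm : MeasurableSet {ω | b ≤ Z ω} := measurableSet_le measurable_const hZ
    have hi : Integrable (fun ω => C + Y ω) (μ.restrict {ω | b ≤ Z ω}) :=
      ((integrable_const C).add (hintg hY hb)).integrableOn
    rw [Measure.map_apply hZ measurableSet_Ici, ← integral_add (integrable_const C)
      (hintg hY hb).integrableOn, ofReal_integral_eq_lintegral_ofReal hi (.of_forall (hnn hb))]
    exact withDensity_apply _ hm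
  have hfin {Y : Ω → ℝ} (hY : AEStronglyMeasurable Y μ) (hb : ∀ ω, |Y ω| ≤ C) :
      IsFiniteMeasure (ν Y) := by
    have := isFiniteMeasure_withDensity_ofReal ((integrable_const C).add (hintg hY hb)).2
    exact Measure.isFiniteMeasure_map _ Z
  have hν : ν Y₁ = ν Y₂ := by
    have := hfin h₁ hb₁
    exact Measure.ext_of_Ici _ _ fun b => by rw [hIci h₁ hb₁, hIci h₂ hb₂, h b]
  have hgZ : AEStronglyMeasurable (fun ω => g (Z ω)) μ := (hg.comp hZ).aestronglyMeasurable
  have hgint : Integrable (fun ω => g (Z ω)) μ := .of_bound hgZ K (.of_forall fun ω => hgb _)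
  have hval {Y : Ω → ℝ} (hY : AEStronglyMeasurable Y μ) (hb : ∀ ω, |Y ω| ≤ C) :
      ∫ x, g x ∂(ν Y) = C * ∫ ω, g (Z ω) ∂μ + ∫ ω, Y ω * g (Z ω) ∂μ := by
    rw [integral_map hZ.aemeasurable hg.aestronglyMeasurable,
      integral_withDensity_eq_integral_toReal_smul₀
        (hY.aemeasurable.const_add C).ennreal_ofReal (.of_forall fun _ => ENNReal.ofReal_lt_top),
      ← integral_const_mul, ← integral_add (hgint.const_mul C)
        (hgint.bdd_mul hY (.of_forall hb))]
    refine integral_congr_ae (.of_forall fun ω => ?_)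
    simp only [ENNReal.toReal_ofReal (hnn hb ω), smul_eq_mul, add_mul]
  have := (hval h₁ hb₁).symm.trans ((congrArg (fun ν => ∫ x, g x ∂ν) hν).trans (hval h₂ hb₂))
  exact add_left_cancel this

/-- **core identity for Theorem 1.1.** Let `M` be a nonnegative continuous
martingale with `M 0 = 1` a.s. and `M t → 0` a.s. as `t → ∞`, and let
`ρ := inf {t | M t = M*_∞}` be the (a.s. unique and a.s. finite) time of the overall maximum
of `M`. Let `S` be a bounded adapted continuous process such that `M * S` is a martingale.
Then for all `0 ≤ s ≤ t`, every `B ∈ 𝓕_s` and every bounded Borel `f : ℝ → ℝ`,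
`E[S_{ρ∧t} f(1/M*_∞) 1_B] = E[S_{ρ∧s} f(1/M*_∞) 1_B]`. -/
theorem stopped_price_martingale_identity
    {Ω : Type*} {m : MeasurableSpace Ω} {P : Measure Ω} [IsProbabilityMeasure P]
    (ℱ : Filtration ℝ≥0 m) (M : ℝ≥0 → Ω → ℝ)
    (hMmart : Martingale M ℱ P)
    (hMnonneg : ∀ t ω, 0 ≤ M t ω)
    (hMcont : ∀ ω, Continuous fun t => M t ω)
    (hM0 : ∀ᵐ ω ∂P, M 0 ω = 1)
    (hMlim : ∀ᵐ ω ∂P, Tendsto (fun t => M t ω) atTop (nhds (0 : ℝ)))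
    (ρ : Ω → ℝ≥0) (hρ : ∀ ω, ρ ω = sInf {u : ℝ≥0 | M u ω = ⨆ v, M v ω})
    (S : ℝ≥0 → Ω → ℝ) (C : ℝ) (hSbdd : ∀ t ω, |S t ω| ≤ C)
    (hSadapted : Adapted ℱ S)
    (hScont : ∀ ω, Continuous fun t => S t ω)
    (hMS : Martingale (fun t ω => M t ω * S t ω) ℱ P)
    (s t : ℝ≥0) (hst : s ≤ t) (B : Set Ω) (hB : MeasurableSet[ℱ s] B)
    (f : ℝ → ℝ) (hfmeas : Measurable f) (Cf : ℝ) (hfbdd : ∀ x, |f x| ≤ Cf) :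
    ∫ ω in B, S (min (ρ ω) t) ω * f ((⨆ v, M v ω)⁻¹) ∂P
      = ∫ ω in B, S (min (ρ ω) s) ω * f ((⨆ v, M v ω)⁻¹) ∂P := by
  have hSa' : StronglyAdapted ℱ S := fun t => (hSadapted t).stronglyMeasurable
  have hsup : Measurable fun ω => ⨆ v, M v ω :=
    measurable_iSup_of_continuous (fun t => ((hMmart.1 t).mono (ℱ.le t)).measurable) hMcont
  have hmeas r := (aestronglyMeasurable_eval_firstArgmax hMmart.1 hMcont hM0 hMlim hρ hSa' hScont
    r).restrict (s := B)
  refine integral_mul_comp_eq_of_setIntegral_le_eq (hmeas t) (hmeas s) hsup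
    (fun ω => hSbdd _ ω) (fun ω => hSbdd _ ω) (fun b => ?_) (hfmeas.comp measurable_inv)
    (fun x => hfbdd x⁻¹)
  rw [Measure.restrict_restrict (measurableSet_le measurable_const hsup), inter_comm]
  exact setIntegral_eval_firstArgmax_eq hMmart hMnonneg hMcont hM0 hMlim hρ hSbdd hSadapted hScont
    hMS b hst hB
end

section
/- Let ρ := inf{t ≥ 0 : M_t = M*_∞} be the (a.s. unique and a.s. finite) time at which M attains its overall maximum. Let S = (S_t)_{t ≥ 0} be a bounded real-valued adapted process with continuous sample paths such that the product process (M_t S_t)_{t ≥ 0} is a martingale with respect to (𝓕_t) and P. For s ≥ 0 define the enlarged σ-algebra 𝓖_s := 𝓕_s ⊔ σ(M*_∞), the σ-algebra generated by 𝓕_s together with the random variable M*_∞. Then for all 0 ≤ s ≤ t, E[S_{ρ∧t} | 𝓖_s] = S_{ρ∧s} almost surely; that is, the stopped process (S_{ρ∧t})_{t ≥ 0} is a martingale with respect to the enlarged filtration (𝓖_t)_{t ≥ 0} and P. -/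
open MeasureTheory Filter Set
open scoped NNReal ENNReal

section OptionalSampling

variable {Ω : Type*} {m : MeasurableSpace Ω} {P : Measure Ω} {ℱ : Filtration ℝ≥0 m}

/-- The upper approximation of the time `τ`, capped at `T`, on the grid of mesh `1 / (n + 1)`. -/
noncomputable def gridTime (τ : Ω → ℝ≥0) (T : ℝ≥0) (n : ℕ) (ω : Ω) : ℝ≥0 :=
  min (((⌊(n + 1 : ℝ≥0) * τ ω⌋₊ + 1 : ℕ) : ℝ≥0) / (n + 1)) T

lemma gridTime_le (τ : Ω → ℝ≥0) (T : ℝ≥0) (n : ℕ) (ω : Ω) : gridTime τ T n ω ≤ T :=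
  min_le_right _ _

lemma le_gridTime {τ : Ω → ℝ≥0} {T : ℝ≥0} (hτT : ∀ ω, τ ω ≤ T) (n : ℕ) (ω : Ω) :
    τ ω ≤ gridTime τ T n ω := by
  refine le_min ?_ (hτT ω)
  rw [le_div_iff₀ (by positivity), mul_comm]
  exact_mod_cast (Nat.lt_floor_add_one _).le

lemma tendsto_gridTime {τ : Ω → ℝ≥0} {T : ℝ≥0} (hτT : ∀ ω, τ ω ≤ T) (ω : Ω) :
    Tendsto (fun n => gridTime τ T n ω) atTop (nhds (τ ω)) := by
  have hup : Tendsto (fun n : ℕ => τ ω + 1 / ((n : ℝ≥0) + 1)) atTop (nhds (τ ω + 0)) :=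
    tendsto_const_nhds.add tendsto_one_div_add_atTop_nhds_zero_nat
  rw [add_zero] at hup
  refine tendsto_of_tendsto_of_tendsto_of_le_of_le tendsto_const_nhds hup
    (fun n => le_gridTime hτT n ω) fun n => (min_le_left _ _).trans ?_
  rw [div_le_iff₀ (by positivity), add_mul (τ ω), one_div, inv_mul_cancel₀ (by positivity)]
  push_cast
  gcongr
  rw [mul_comm]
  exact Nat.floor_le zero_le

lemma countable_range_gridTime (τ : Ω → ℝ≥0) (T : ℝ≥0) (n : ℕ) :
    (range fun ω => (gridTime τ T n ω : WithTop ℝ≥0)).Countable := by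
  refine (countable_range
    fun k : ℕ => ((min (((k + 1 : ℕ) : ℝ≥0) / (n + 1)) T : ℝ≥0) : WithTop ℝ≥0)).mono ?_
  rintro _ ⟨ω, rfl⟩
  exact ⟨_, rfl⟩

lemma isStoppingTime_gridTime {τ : Ω → ℝ≥0}
    (hτ : IsStoppingTime ℱ fun ω => (τ ω : WithTop ℝ≥0)) (T : ℝ≥0) (n : ℕ) :
    IsStoppingTime ℱ fun ω => (gridTime τ T n ω : WithTop ℝ≥0) := by
  intro v
  simp only [WithTop.coe_le_coe]
  rcases le_or_gt T v with hTv | hvT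
  · simp [(gridTime_le τ T n _).trans hTv]
  · have hv : (⌊(n + 1 : ℝ≥0) * v⌋₊ : ℝ≥0) / (n + 1) ≤ v := by
      rw [div_le_iff₀ (by positivity), mul_comm]
      exact Nat.floor_le zero_le
    convert hτ.measurableSet_lt_le hv using 1
    ext ω
    simp only [gridTime, mem_ofPred_eq, min_le_iff, not_le.2 hvT, or_false, WithTop.coe_lt_coe]
    rw [div_le_iff₀ (by positivity), lt_div_iff₀ (by positivity), mul_comm v, mul_comm (τ ω),
      ← Nat.le_floor_iff zero_le, Nat.succ_le_iff, Nat.floor_lt zero_le]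

variable [IsProbabilityMeasure P] {X : ℝ≥0 → Ω → ℝ}

lemma MeasureTheory.Martingale.integrable_and_ae_eq_condExp_of_continuous
    (hX : Martingale X ℱ P) (hXc : ∀ ω, Continuous fun t => X t ω) {τ : Ω → ℝ≥0}
    (hτ : IsStoppingTime ℱ fun ω => (τ ω : WithTop ℝ≥0)) {T : ℝ≥0} (hτT : ∀ ω, τ ω ≤ T) :
    Integrable (fun ω => X (τ ω) ω) P ∧
      (fun ω => X (τ ω) ω) =ᵐ[P] P[X T | hτ.measurableSpace] := by
  have hg := isStoppingTime_gridTime hτ T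
  have hgrid (n : ℕ) : (fun ω => X (gridTime τ T n ω) ω) =ᵐ[P] P[X T | (hg n).measurableSpace] :=
    hX.stoppedValue_ae_eq_condExp_of_le_const_of_countable_range (hg n)
      (fun ω => WithTop.coe_le_coe.2 (gridTime_le τ T n ω)) (countable_range_gridTime τ T n)
  have hUI : UniformIntegrable (fun n ω => X (gridTime τ T n ω) ω) 1 P :=
    ((hX.integrable T).uniformIntegrable_condExp fun n => (hg n).measurableSpace_le).ae_eq
      fun n => (hgrid n).symm
  have hlim : ∀ᵐ ω ∂P, Tendsto (fun n => X (gridTime τ T n ω) ω) atTop (nhds (X (τ ω) ω)) :=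
    .of_forall fun ω => ((hXc ω).tendsto _).comp (tendsto_gridTime hτT ω)
  have hint : Integrable (fun ω => X (τ ω) ω) P := hUI.integrable_of_ae_tendsto hlim
  have hL1 := tendsto_Lp_finite_of_tendsto_ae le_rfl ENNReal.one_ne_top hUI.1
    (memLp_one_iff_integrable.2 hint) hUI.unifIntegrable hlim
  refine ⟨hint, ae_eq_condExp_of_forall_setIntegral_eq hτ.measurableSpace_le (hX.integrable T)
    (fun _ _ _ => hint.integrableOn) (fun A hA _ => ?_) ?_⟩
  · have hconv := tendsto_setIntegral_of_L1' _ hint.1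
      (.of_forall fun n => (integrable_congr (hgrid n)).2 integrable_condExp) hL1 A
    refine tendsto_nhds_unique hconv (tendsto_const_nhds.congr fun n => ?_)
    have hle : hτ.measurableSpace ≤ (hg n).measurableSpace :=
      hτ.measurableSpace_mono (hg n) fun ω => WithTop.coe_le_coe.2 (le_gridTime hτT n ω)
    rw [setIntegral_congr_ae ((hg n).measurableSpace_le _ (hle _ hA))
      ((hgrid n).mono fun ω h _ => h),
      setIntegral_condExp (hg n).measurableSpace_le (hX.integrable T) (hle _ hA)]
  · exact (measurable_stoppedValue (hX.1.isStronglyProgressive_of_continuous hXc)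
      hτ).stronglyMeasurable.aestronglyMeasurable

/-- Optional sampling at a bounded time for a continuous martingale. -/
lemma MeasureTheory.Martingale.setIntegral_bounded_time
    (hX : Martingale X ℱ P) (hXc : ∀ ω, Continuous fun t => X t ω) {τ : Ω → ℝ≥0}
    (hτ : IsStoppingTime ℱ fun ω => (τ ω : WithTop ℝ≥0)) {T : ℝ≥0} (hτT : ∀ ω, τ ω ≤ T)
    {A : Set Ω} (hA : MeasurableSet[hτ.measurableSpace] A) :
    ∫ ω in A, X (τ ω) ω ∂P = ∫ ω in A, X T ω ∂P := by
  rw [setIntegral_congr_ae (hτ.measurableSpace_le _ hA)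
    ((hX.integrable_and_ae_eq_condExp_of_continuous hXc hτ hτT).2.mono fun ω h _ => h),
    setIntegral_condExp hτ.measurableSpace_le (hX.integrable T) hA]

/-- Optional sampling between two bounded times for a continuous martingale. -/
lemma MeasureTheory.Martingale.condExp_bounded_time
    (hX : Martingale X ℱ P) (hXc : ∀ ω, Continuous fun t => X t ω) {σ τ : Ω → ℝ≥0}
    (hσ : IsStoppingTime ℱ fun ω => (σ ω : WithTop ℝ≥0))
    (hτ : IsStoppingTime ℱ fun ω => (τ ω : WithTop ℝ≥0)) (hστ : ∀ ω, σ ω ≤ τ ω)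
    {T : ℝ≥0} (hτT : ∀ ω, τ ω ≤ T) :
    P[fun ω => X (τ ω) ω | hσ.measurableSpace] =ᵐ[P] fun ω => X (σ ω) ω := by
  have hle : hσ.measurableSpace ≤ hτ.measurableSpace :=
    hσ.measurableSpace_mono hτ fun ω => WithTop.coe_le_coe.2 (hστ ω)
  exact (condExp_congr_ae (hX.integrable_and_ae_eq_condExp_of_continuous hXc hτ hτT).2).trans
    ((condExp_condExp_of_le hle hτ.measurableSpace_le).trans
      (hX.integrable_and_ae_eq_condExp_of_continuous hXc hσ
        fun ω => (hστ ω).trans (hτT ω)).2.symm)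

end OptionalSampling

section HitTime

variable {Ω : Type*} {m : MeasurableSpace Ω} {ℱ : Filtration ℝ≥0 m} {M : ℝ≥0 → Ω → ℝ}

/-- The first time at which `M` reaches the level `x`, capped at `u`. -/
noncomputable def hitTime (M : ℝ≥0 → Ω → ℝ) (x : ℝ) (u : ℝ≥0) (ω : Ω) : ℝ≥0 :=
  sInf ({r | x ≤ M r ω} ∪ {u})

variable {x y : ℝ} {r s t u v : ℝ≥0} {ω : Ω}

lemma hitTime_le (M : ℝ≥0 → Ω → ℝ) (x : ℝ) (u : ℝ≥0) (ω : Ω) : hitTime M x u ω ≤ u :=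
  csInf_le (OrderBot.bddBelow _) (.inr rfl)

lemma hitTime_le_of_le (h : x ≤ M r ω) : hitTime M x u ω ≤ r :=
  csInf_le (OrderBot.bddBelow _) (.inl h)

lemma lt_of_lt_hitTime (h : r < hitTime M x u ω) : M r ω < x :=
  lt_of_not_ge fun h' => (hitTime_le_of_le h').not_gt h

lemma hitTime_spec (hc : Continuous fun t => M t ω) :
    x ≤ M (hitTime M x u ω) ω ∨ hitTime M x u ω = u :=
  ((isClosed_le continuous_const hc).union isClosed_singleton).csInf_mem ⟨u, .inr rfl⟩
    (OrderBot.bddBelow _)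

lemma hitTime_mono (hc : Continuous fun t => M t ω) (hxy : x ≤ y) (huv : u ≤ v) :
    hitTime M x u ω ≤ hitTime M y v ω := by
  rcases hitTime_spec (x := y) (u := v) hc with h | h
  · exact hitTime_le_of_le (hxy.trans h)
  · rw [h]
    exact (hitTime_le M x u ω).trans huv

lemma apply_le_of_le_hitTime (hc : Continuous fun t => M t ω) (h0 : M 0 ω ≤ x)
    (hr : r ≤ hitTime M x u ω) : M r ω ≤ x := by
  rcases eq_or_ne r 0 with rfl | hr0
  · exact h0
  have : (nhdsWithin r (Iio r)).NeBot := nhdsLT_neBot_of_exists_lt ⟨0, pos_iff_ne_zero.2 hr0⟩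
  refine le_of_tendsto ((hc.tendsto r).mono_left (nhdsWithin_le_nhds (s := Iio r))) ?_
  filter_upwards [self_mem_nhdsWithin] with q hq
  exact (lt_of_lt_hitTime (lt_of_lt_of_le hq hr)).le

lemma hitTime_eq_of_exists_le (hc : Continuous fun t => M t ω) (hst : s ≤ t)
    (h : ∃ r ≤ s, x ≤ M r ω) : hitTime M x t ω = hitTime M x s ω := by
  obtain ⟨r, hrs, hr⟩ := h
  refine le_antisymm ?_ (hitTime_mono hc le_rfl hst)
  rcases hitTime_spec (x := x) (u := s) hc with h | h
  · exact hitTime_le_of_le h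
  · rw [h]
    exact (hitTime_le_of_le hr).trans hrs

lemma measurableSet_exists_le (hM : StronglyAdapted ℱ M)
    (hMc : ∀ ω, Continuous fun t => M t ω) (x : ℝ) (v : ℝ≥0) :
    MeasurableSet[ℱ v] {ω | ∃ r ≤ v, x ≤ M r ω} := by
  obtain ⟨D, hDc, hD⟩ := TopologicalSpace.exists_countable_dense (Icc 0 v)
  have : Nonempty (Icc 0 v) := ⟨⟨0, by simp⟩⟩
  have hcont (ω : Ω) : Continuous fun r : Icc 0 v => M r ω := (hMc ω).comp continuous_subtype_val
  have hset : {ω | ∃ r ≤ v, x ≤ M r ω} = {ω | x ≤ ⨆ r : D, M r ω} := by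
    ext ω
    simp only [mem_ofPred_eq, hD.ciSup' (hcont ω)]
    constructor
    · rintro ⟨r, hrv, hr⟩
      exact hr.trans (le_ciSup (isCompact_range (hcont ω)).bddAbove ⟨r, zero_le, hrv⟩)
    · intro h
      obtain ⟨r, hr⟩ := (isCompact_range (hcont ω)).sSup_mem (range_nonempty _)
      exact ⟨r, r.2.2, h.trans hr.ge⟩
  have := hDc.to_subtype
  rw [hset]
  exact @measurableSet_le _ _ _ _ _ (ℱ v) _ _ _ _ _ measurable_const
    (Measurable.iSup fun r : D => ((hM _).mono (ℱ.mono r.1.2.2)).measurable)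

lemma isStoppingTime_hitTime (hM : StronglyAdapted ℱ M)
    (hMc : ∀ ω, Continuous fun t => M t ω) (x : ℝ) (u : ℝ≥0) :
    IsStoppingTime ℱ fun ω => (hitTime M x u ω : WithTop ℝ≥0) := by
  intro v
  simp only [WithTop.coe_le_coe]
  rcases le_or_gt u v with huv | hvu
  · simp [(hitTime_le M x u _).trans huv]
  · convert measurableSet_exists_le hM hMc x v using 1
    ext ω
    refine ⟨fun h => ⟨_, h, (hitTime_spec (hMc ω)).resolve_right ?_⟩, ?_⟩
    · exact (lt_of_le_of_lt h hvu).ne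
    · rintro ⟨r, hrv, hr⟩
      exact (hitTime_le_of_le hr).trans hrv

/-- An event of `ℱ s` on which the level `x` is not reached before `s` is known when `x` is
reached. -/
lemma measurableSet_hitTime_inter (hM : StronglyAdapted ℱ M)
    (hMc : ∀ ω, Continuous fun t => M t ω) (x : ℝ) (hsu : s ≤ u) {A : Set Ω}
    (hA : MeasurableSet[ℱ s] A) :
    MeasurableSet[(isStoppingTime_hitTime hM hMc x u).measurableSpace]
      (A \ {ω | ∃ r ≤ s, x ≤ M r ω}) := by
  have hAD := hA.diff (measurableSet_exists_le hM hMc x s)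
  refine ⟨le_iSup (fun i => (ℱ i : MeasurableSpace Ω)) s _ hAD, fun v => ?_⟩
  simp only [WithTop.coe_le_coe]
  rcases le_or_gt s v with hsv | hvs
  · refine (ℱ.mono hsv _ hAD).inter ?_
    simpa only [WithTop.coe_le_coe] using isStoppingTime_hitTime hM hMc x u v
  · convert @MeasurableSet.empty _ (ℱ v)
    refine eq_empty_of_forall_notMem fun ω hω => hω.1.2 ⟨_, (hω.2.trans hvs.le), ?_⟩
    exact (hitTime_spec (hMc ω)).resolve_right (lt_of_le_of_lt hω.2 (hvs.trans_le hsu)).ne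

end HitTime

section MaximalIdentity

variable {Ω : Type*} {m : MeasurableSpace Ω} {P : Measure Ω} [IsProbabilityMeasure P]
  {ℱ : Filtration ℝ≥0 m} {M S : ℝ≥0 → Ω → ℝ} {C x y z : ℝ} {s t u : ℝ≥0}

lemma measurableSet_exists_le_apply (hM : StronglyAdapted ℱ M)
    (hMc : ∀ ω, Continuous fun t => M t ω) (y : ℝ) : MeasurableSet {ω | ∃ r, y ≤ M r ω} := by
  have : {ω | ∃ r, y ≤ M r ω} = ⋃ n : ℕ, {ω | ∃ r ≤ (n : ℝ≥0), y ≤ M r ω} := by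
    ext ω
    simp only [mem_ofPred_eq, mem_iUnion]
    constructor
    · rintro ⟨r, hr⟩
      obtain ⟨n, hn⟩ := exists_nat_ge r
      exact ⟨n, r, hn, hr⟩
    · rintro ⟨_, r, _, hr⟩
      exact ⟨r, hr⟩
  rw [this]
  exact .iUnion fun n => ℱ.le _ _ (measurableSet_exists_le hM hMc y n)

lemma tendsto_apply_hitTime {ω : Ω} (hc : Continuous fun t => M t ω) (h0 : M 0 ω = 1)
    (hlim : Tendsto (fun t => M t ω) atTop (nhds 0)) (hy : 1 ≤ y) (T : ℝ≥0) :
    Tendsto (fun n : ℕ => M (hitTime M y (T + n) ω) ω) atTop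
      (nhds ({ω | ∃ r, y ≤ M r ω}.indicator (fun _ => y) ω)) := by
  have hT : Tendsto (fun n : ℕ => T + (n : ℝ≥0)) atTop atTop :=
    tendsto_atTop_mono (fun n => le_add_self) tendsto_natCast_atTop_atTop
  by_cases h : ω ∈ {ω | ∃ r, y ≤ M r ω}
  · rw [indicator_of_mem h]
    obtain ⟨r, hr⟩ := h
    refine tendsto_const_nhds.congr' ?_
    filter_upwards [hT.eventually (eventually_gt_atTop r)] with n hn
    refine le_antisymm ((hitTime_spec hc).resolve_right ?_)
      (apply_le_of_le_hitTime hc (h0.le.trans hy) le_rfl)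
    exact (lt_of_le_of_lt (hitTime_le_of_le hr) hn).ne
  · rw [indicator_of_notMem h]
    refine (hlim.comp hT).congr fun n => ?_
    rw [(hitTime_spec hc).resolve_left fun h' => h ⟨_, h'⟩, Function.comp_apply]

/-- A form of Doob's maximal identity: the conditional probability at `σ` that `M` reaches the
level `y` is `M σ / y`, as long as `σ` precedes the time `y` is reached. -/
lemma integral_mul_apply_eq_of_le_hitTime
    (hM : Martingale M ℱ P) (hM_nonneg : ∀ t ω, 0 ≤ M t ω)
    (hMc : ∀ ω, Continuous fun t => M t ω) (hM0 : ∀ᵐ ω ∂P, M 0 ω = 1)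
    (hMlim : ∀ᵐ ω ∂P, Tendsto (fun t => M t ω) atTop (nhds 0)) (hy : 1 ≤ y) {σ : Ω → ℝ≥0}
    (hσ : IsStoppingTime ℱ fun ω => (σ ω : WithTop ℝ≥0)) {T : ℝ≥0}
    (hσT : ∀ ω, σ ω ≤ hitTime M y T ω) {H : Ω → ℝ} (hH : StronglyMeasurable[hσ.measurableSpace] H)
    (hHC : ∀ ω, ‖H ω‖ ≤ C) :
    ∫ ω, H ω * M (σ ω) ω ∂P = y * ∫ ω in {ω | ∃ r, y ≤ M r ω}, H ω ∂P := by
  have hHm := (hH.mono hσ.measurableSpace_le).aestronglyMeasurable (μ := P)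
  have hst (n : ℕ) := isStoppingTime_hitTime hM.1 hMc y (T + n)
  have hint (n : ℕ) : Integrable (fun ω => M (hitTime M y (T + n) ω) ω) P :=
    (hM.integrable_and_ae_eq_condExp_of_continuous hMc (hst n) (hitTime_le M y _)).1
  have hconst (n : ℕ) : ∫ ω, H ω * M (hitTime M y (T + n) ω) ω ∂P = ∫ ω, H ω * M (σ ω) ω ∂P := by
    have hcond := hM.condExp_bounded_time hMc hσ (hst n)
      (fun ω => (hσT ω).trans (hitTime_mono (hMc ω) le_rfl (by simp))) (hitTime_le M y _)
    have hpull := condExp_stronglyMeasurable_mul_of_bound hσ.measurableSpace_le hH (hint n) C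
      (.of_forall hHC)
    rw [← integral_condExp hσ.measurableSpace_le (f := fun ω => H ω * _)]
    refine integral_congr_ae (hpull.trans ?_)
    filter_upwards [hcond] with ω hω
    rw [Pi.mul_apply, hω]
  have hE := measurableSet_exists_le_apply hM.1 hMc y
  have hlim := tendsto_integral_of_dominated_convergence (μ := P)
    (F := fun n ω => H ω * M (hitTime M y (T + n) ω) ω)
    (f := fun ω => H ω * {ω | ∃ r, y ≤ M r ω}.indicator (fun _ => y) ω) (fun _ => C * y)
    (fun n => hHm.mul (hint n).1) (integrable_const _) (fun n => by
      filter_upwards [hM0] with ω h0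
      rw [norm_mul, Real.norm_of_nonneg (hM_nonneg _ _)]
      exact mul_le_mul (hHC ω) (apply_le_of_le_hitTime (hMc ω) (h0.le.trans hy) le_rfl)
        (hM_nonneg _ _) ((norm_nonneg _).trans (hHC ω))) (by
      filter_upwards [hM0, hMlim] with ω h0 hl
      exact (tendsto_apply_hitTime (hMc ω) h0 hl hy T).const_mul _)
  simp only [hconst] at hlim
  rw [tendsto_nhds_unique tendsto_const_nhds hlim, ← integral_const_mul, ← integral_indicator hE]
  congr 1 with ω
  by_cases h : ω ∈ {ω | ∃ r, y ≤ M r ω} <;> simp [h, mul_comm]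

lemma setIntegral_diff_apply_hitTime_eq
    (hM : Martingale M ℱ P) (hM_nonneg : ∀ t ω, 0 ≤ M t ω)
    (hMc : ∀ ω, Continuous fun t => M t ω) (hM0 : ∀ᵐ ω ∂P, M 0 ω = 1)
    (hMlim : ∀ᵐ ω ∂P, Tendsto (fun t => M t ω) atTop (nhds 0))
    (hS_bdd : ∀ t ω, |S t ω| ≤ C) (hS : StronglyAdapted ℱ S)
    (hSc : ∀ ω, Continuous fun t => S t ω) (hMS : Martingale (fun t ω => M t ω * S t ω) ℱ P)
    (hy : 1 ≤ y) (hxy : x ≤ y) (hsu : s ≤ u) {A : Set Ω} (hA : MeasurableSet[ℱ s] A) :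
    y * ∫ ω in (A \ {ω | ∃ r ≤ s, x ≤ M r ω}) ∩ {ω | ∃ r, y ≤ M r ω}, S (hitTime M x u ω) ω ∂P =
      ∫ ω in A \ {ω | ∃ r ≤ s, x ≤ M r ω}, M s ω * S s ω ∂P := by
  set B := A \ {ω | ∃ r ≤ s, x ≤ M r ω} with hB
  have hBs : MeasurableSet[ℱ s] B := hA.diff (measurableSet_exists_le hM.1 hMc x s)
  have hBσ := measurableSet_hitTime_inter hM.1 hMc x hsu hA
  have hσ := isStoppingTime_hitTime hM.1 hMc x u
  have hSσ : StronglyMeasurable[hσ.measurableSpace] fun ω => S (hitTime M x u ω) ω :=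
    (measurable_stoppedValue (hS.isStronglyProgressive_of_continuous hSc) hσ).stronglyMeasurable
  have hkey := integral_mul_apply_eq_of_le_hitTime hM hM_nonneg hMc hM0 hMlim hy hσ (T := u)
    (fun ω => hitTime_mono (hMc ω) hxy le_rfl) (hSσ.indicator hBσ) (C := C)
    fun ω => (norm_indicator_le_norm_self _ _).trans (hS_bdd _ _)
  have hE := measurableSet_exists_le_apply hM.1 hMc y
  have hBm : MeasurableSet B := ℱ.le s _ hBs
  rw [setIntegral_indicator hBm, inter_comm] at hkey
  rw [hMS.setIntegral_eq hsu hBs, ← hMS.setIntegral_bounded_time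
    (fun ω => (hMc ω).mul (hSc ω)) hσ (hitTime_le M x u) hBσ, ← hkey, ← integral_indicator hBm]
  congr 1 with ω
  by_cases h : ω ∈ B <;> simp [← hB, h, mul_comm]

lemma setIntegral_apply_hitTime_eq
    (hM : Martingale M ℱ P) (hM_nonneg : ∀ t ω, 0 ≤ M t ω)
    (hMc : ∀ ω, Continuous fun t => M t ω) (hM0 : ∀ᵐ ω ∂P, M 0 ω = 1)
    (hMlim : ∀ᵐ ω ∂P, Tendsto (fun t => M t ω) atTop (nhds 0))
    (hS_bdd : ∀ t ω, |S t ω| ≤ C) (hS : StronglyAdapted ℱ S)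
    (hSc : ∀ ω, Continuous fun t => S t ω) (hMS : Martingale (fun t ω => M t ω * S t ω) ℱ P)
    (hy : 1 ≤ y) (hxy : x ≤ y) (hst : s ≤ t) {A : Set Ω} (hA : MeasurableSet[ℱ s] A) :
    ∫ ω in A ∩ {ω | ∃ r, y ≤ M r ω},
      (S (hitTime M x t ω) ω - S (hitTime M x s ω) ω) ∂P = 0 := by
  have hint (u : ℝ≥0) : Integrable (fun ω => S (hitTime M x u ω) ω) P := by
    refine .of_bound (((measurable_stoppedValue (hS.isStronglyProgressive_of_continuous hSc)
      (isStoppingTime_hitTime hM.1 hMc x u)).mono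
      (IsStoppingTime.measurableSpace_le _) le_rfl).aestronglyMeasurable) C ?_
    exact .of_forall fun ω => hS_bdd _ _
  have hE := measurableSet_exists_le_apply hM.1 hMc y
  rw [setIntegral_eq_of_subset_of_forall_sdiff_eq_zero ((ℱ.le s _ hA).inter hE)
    (inter_subset_inter_left _ (sdiff_subset (t := {ω | ∃ r ≤ s, x ≤ M r ω}))),
    integral_sub (hint t).integrableOn (hint s).integrableOn, sub_eq_zero]
  · refine mul_left_cancel₀ (zero_lt_one.trans_le hy).ne' ?_
    rw [setIntegral_diff_apply_hitTime_eq hM hM_nonneg hMc hM0 hMlim hS_bdd hS hSc hMS hy hxy hst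
      hA, setIntegral_diff_apply_hitTime_eq hM hM_nonneg hMc hM0 hMlim hS_bdd hS hSc hMS hy hxy
      le_rfl hA]
  · rintro ω ⟨⟨hωA, hωE⟩, hω⟩
    rw [hitTime_eq_of_exists_le (hMc ω) hst, sub_self]
    by_contra h
    exact hω ⟨⟨hωA, h⟩, hωE⟩

end MaximalIdentity

section LevelApproximation

variable {Ω : Type*} {M S : ℝ≥0 → Ω → ℝ}

/-- The index of the last level `b + k / (n + 1)` that does not exceed the overall supremum. -/
noncomputable def levelIndex (M : ℝ≥0 → Ω → ℝ) (b : ℝ) (n : ℕ) (ω : Ω) : ℕ :=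
  ⌊(n + 1 : ℝ) * ((⨆ v, M v ω) - b)⌋₊

/-- The time, capped at `u`, at which `M` reaches the last level `b + k / (n + 1)` that does not
exceed its overall supremum. -/
noncomputable def lastLevelTime (M : ℝ≥0 → Ω → ℝ) (b : ℝ) (n : ℕ) (u : ℝ≥0) (ω : Ω) : ℝ≥0 :=
  hitTime M (b + levelIndex M b n ω / (n + 1)) u ω

lemma exists_isMax_of_tendsto_zero {f : ℝ≥0 → ℝ} (hf : Continuous f) (h0 : f 0 = 1)
    (hlim : Tendsto f atTop (nhds 0)) : ∃ r, f r = ⨆ v, f v ∧ ∀ v, f v ≤ f r := by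
  obtain ⟨r, hr⟩ := hf.exists_forall_ge' 0 (by
    rw [cocompact_eq_atTop, h0]
    exact (hlim.eventually (eventually_lt_nhds zero_lt_one)).mono fun _ h => h.le)
  exact ⟨r, le_antisymm (le_ciSup ⟨f r, by rintro _ ⟨v, rfl⟩; exact hr v⟩ r) (ciSup_le hr), hr⟩

lemma exists_le_iff_le_iSup {f : ℝ≥0 → ℝ} (hf : Continuous f) (h0 : f 0 = 1)
    (hlim : Tendsto f atTop (nhds 0)) (y : ℝ) : (∃ r, y ≤ f r) ↔ y ≤ ⨆ v, f v := by
  obtain ⟨q, hq, hmax⟩ := exists_isMax_of_tendsto_zero hf h0 hlim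
  exact ⟨fun ⟨r, hr⟩ => hq ▸ hr.trans (hmax r), fun h => ⟨q, hq ▸ h⟩⟩

lemma one_le_iSup {f : ℝ≥0 → ℝ} (hf : Continuous f) (h0 : f 0 = 1)
    (hlim : Tendsto f atTop (nhds 0)) : 1 ≤ ⨆ v, f v :=
  (exists_le_iff_le_iSup hf h0 hlim 1).1 ⟨0, h0.ge⟩

lemma tendsto_lastLevelTime {ω : Ω} (hc : Continuous fun t => M t ω) (h0 : M 0 ω = 1)
    (hlim : Tendsto (fun t => M t ω) atTop (nhds 0)) {b : ℝ} (hb : b ≤ ⨆ v, M v ω) (u : ℝ≥0) :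
    Tendsto (fun n => lastLevelTime M b n u ω) atTop
      (nhds (min (sInf {r : ℝ≥0 | M r ω = ⨆ v, M v ω}) u)) := by
  obtain ⟨q, hq, hmax⟩ := exists_isMax_of_tendsto_zero hc h0 hlim
  have hρ : M (sInf {r : ℝ≥0 | M r ω = ⨆ v, M v ω}) ω = ⨆ v, M v ω :=
    (isClosed_eq hc continuous_const).csInf_mem ⟨q, hq⟩ (OrderBot.bddBelow _)
  set ρ := sInf {r : ℝ≥0 | M r ω = ⨆ v, M v ω} with hρ_def
  have hlevel_le (n : ℕ) : b + levelIndex M b n ω / (n + 1) ≤ ⨆ v, M v ω := by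
    rw [← le_sub_iff_add_le', div_le_iff₀ (by positivity), mul_comm]
    exact Nat.floor_le (mul_nonneg (by positivity) (sub_nonneg.2 hb))
  have hle (n : ℕ) : lastLevelTime M b n u ω ≤ min ρ u :=
    le_min (hitTime_le_of_le (hρ ▸ hlevel_le n)) (hitTime_le _ _ _ _)
  refine tendsto_order.2 ⟨fun r hr => ?_, fun r hr => .of_forall fun n => (hle n).trans_lt hr⟩
  obtain ⟨p, hp, hpmax⟩ := (isCompact_Icc (a := (0 : ℝ≥0)) (b := r)).exists_isMaxOn
    ⟨0, by simp⟩ hc.continuousOn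
  have hp_lt : M p ω < ⨆ v, M v ω := by
    refine lt_of_le_of_ne (hq ▸ hmax p) fun h => ?_
    have hmem : p ∈ {r : ℝ≥0 | M r ω = ⨆ v, M v ω} := h
    exact ((csInf_le (OrderBot.bddBelow _) hmem).trans hp.2).not_gt (hr.trans_le (min_le_left _ _))
  have hlow : Tendsto (fun n : ℕ => (⨆ v, M v ω) - 1 / ((n : ℝ) + 1)) atTop
      (nhds ((⨆ v, M v ω) - 0)) := tendsto_const_nhds.sub tendsto_one_div_add_atTop_nhds_zero_nat
  rw [sub_zero] at hlow
  filter_upwards [hlow.eventually (eventually_gt_nhds hp_lt)] with n hn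
  have hlevel : M p ω < b + levelIndex M b n ω / (n + 1) := by
    refine hn.trans_le ?_
    rw [sub_le_iff_le_add, add_assoc, ← add_div, ← sub_le_iff_le_add', le_div_iff₀ (by positivity),
      mul_comm]
    exact (Nat.lt_floor_add_one _).le
  rcases hitTime_spec (x := b + levelIndex M b n ω / (n + 1)) (u := u) hc with h | h
  · by_contra! hcon
    exact (hlevel.trans_le h).not_ge (hpmax ⟨zero_le, hcon⟩)
  · rw [lastLevelTime, h]
    exact hr.trans_le (min_le_right _ _)

lemma measurable_levelIndex {mΩ : MeasurableSpace Ω} (hsup : Measurable fun ω => ⨆ v, M v ω)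
    (b : ℝ) (n : ℕ) : Measurable (levelIndex M b n) :=
  Nat.measurable_floor.comp ((hsup.sub_const b).const_mul _)

lemma measurable_apply_nat_index {mΩ : MeasurableSpace Ω} {F : ℕ → Ω → ℝ} {k : Ω → ℕ}
    (hF : ∀ j, Measurable (F j)) (hk : Measurable k) : Measurable fun ω => F (k ω) ω :=
  (measurable_from_prod_countable_left (f := fun p : Ω × ℕ => F p.2 p.1) hF).comp
    (measurable_id.prodMk hk)

variable {m : MeasurableSpace Ω} {ℱ : Filtration ℝ≥0 m}

lemma measurable_iSup_apply (hM : StronglyAdapted ℱ M)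
    (hMc : ∀ ω, Continuous fun t => M t ω) : Measurable fun ω => ⨆ v, M v ω := by
  obtain ⟨D, hDc, hD⟩ := TopologicalSpace.exists_countable_dense ℝ≥0
  have := hDc.to_subtype
  simp_rw [← fun ω => hD.ciSup' (hMc ω)]
  exact Measurable.iSup fun r : D => ((hM _).mono (ℱ.le r)).measurable

lemma measurable_apply_lastLevelTime (hM : StronglyAdapted ℱ M)
    (hMc : ∀ ω, Continuous fun t => M t ω) (hS : StronglyAdapted ℱ S)
    (hSc : ∀ ω, Continuous fun t => S t ω) (b : ℝ) (n : ℕ) (u : ℝ≥0) :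
    Measurable[(ℱ u : MeasurableSpace Ω) ⊔
      MeasurableSpace.comap (fun ω => ⨆ v, M v ω) Real.measurableSpace]
      fun ω => S (lastLevelTime M b n u ω) ω := by
  have hSk (k : ℕ) : Measurable[ℱ u] fun ω => S (hitTime M (b + k / (n + 1)) u ω) ω :=
    (stronglyMeasurable_stoppedValue_of_le (hS.isStronglyProgressive_of_continuous hSc)
      (isStoppingTime_hitTime hM hMc _ u)
      fun ω => WithTop.coe_le_coe.2 (hitTime_le M _ u ω)).measurable
  have hsup : Measurable[(ℱ u : MeasurableSpace Ω) ⊔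
      MeasurableSpace.comap (fun ω => ⨆ v, M v ω) Real.measurableSpace] fun ω => ⨆ v, M v ω :=
    Measurable.mono (comap_measurable _) le_sup_right le_rfl
  exact measurable_apply_nat_index (F := fun k ω => S (hitTime M (b + (k : ℝ) / (n + 1)) u ω) ω)
    (fun k => (hSk k).mono le_sup_left le_rfl) (measurable_levelIndex hsup b n)

end LevelApproximation

section Enlargement

variable {Ω : Type*} {m : MeasurableSpace Ω} {P : Measure Ω}
  {ℱ : Filtration ℝ≥0 m} {M S : ℝ≥0 → Ω → ℝ} {C b : ℝ} {s t : ℝ≥0}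

lemma le_add_div_floor_iff {a b : ℝ} (n k : ℕ) :
    (b ≤ a ∧ ⌊(n + 1 : ℝ) * (a - b)⌋₊ = k) ↔
      b + k / (n + 1) ≤ a ∧ a < b + ((k + 1 : ℕ) : ℝ) / (n + 1) := by
  have hn : (0 : ℝ) < n + 1 := by positivity
  rw [← le_sub_iff_add_le', div_le_iff₀' hn, ← sub_lt_iff_lt_add', lt_div_iff₀' hn]
  constructor
  · rintro ⟨hb, rfl⟩
    have := mul_nonneg hn.le (sub_nonneg.2 hb)
    exact ⟨Nat.floor_le this, by exact_mod_cast Nat.lt_floor_add_one _⟩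
  · rintro ⟨h1, h2⟩
    have h0 : 0 ≤ (n + 1 : ℝ) * (a - b) := (Nat.cast_nonneg k).trans h1
    exact ⟨sub_nonneg.1 (nonneg_of_mul_nonneg_right h0 hn),
      (Nat.floor_eq_iff h0).2 ⟨h1, by exact_mod_cast h2⟩⟩

lemma sup_comap_iSup_le (hM : StronglyAdapted ℱ M) (hMc : ∀ ω, Continuous fun t => M t ω)
    (u : ℝ≥0) : (ℱ u : MeasurableSpace Ω) ⊔
      MeasurableSpace.comap (fun ω => ⨆ v, M v ω) Real.measurableSpace ≤ m :=
  sup_le (ℱ.le u) (measurable_iSup_apply hM hMc).comap_le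

lemma sup_comap_eq_generateFrom {Ω : Type*} {m₁ : MeasurableSpace Ω} {X : Ω → ℝ}
    (hX : ∀ ω, 0 ≤ X ω) :
    m₁ ⊔ MeasurableSpace.comap X Real.measurableSpace =
      MeasurableSpace.generateFrom
        {B | ∃ A b, MeasurableSet[m₁] A ∧ A ∩ {ω | b ≤ X ω} = B} := by
  refine le_antisymm (sup_le (fun A hA => .basic _ ⟨A, 0, hA, by simp [hX]⟩) ?_)
    (MeasurableSpace.generateFrom_le ?_)
  · refine Measurable.comap_le ?_
    refine measurable_of_Ici fun b => .basic _ ⟨univ, b, .univ, ?_⟩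
    simp [preimage, Ici]
  · rintro _ ⟨A, b, hA, rfl⟩
    exact MeasurableSet.inter (le_sup_left (a := m₁) _ hA)
      (le_sup_right (a := m₁) _ ⟨Ici b, measurableSet_Ici, rfl⟩)

lemma isPiSystem_inter_le {Ω : Type*} {m₁ : MeasurableSpace Ω} {X : Ω → ℝ} :
    IsPiSystem {B | ∃ A b, MeasurableSet[m₁] A ∧ A ∩ {ω | b ≤ X ω} = B} := by
  rintro _ ⟨A, b, hA, rfl⟩ _ ⟨A', b', hA', rfl⟩ _
  refine ⟨A ∩ A', max b b', hA.inter hA', ?_⟩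
  ext ω
  simp only [mem_inter_iff, mem_ofPred_eq, max_le_iff]
  tauto

lemma setIntegral_eq_zero_of_isPiSystem {m₁ : MeasurableSpace Ω} (hm₁ : m₁ ≤ m) {f : Ω → ℝ}
    (hf : Integrable f P) {T : Set (Set Ω)} (hT : m₁ = MeasurableSpace.generateFrom T)
    (hpi : IsPiSystem T) (huniv : ∫ ω, f ω ∂P = 0) (hfT : ∀ B ∈ T, ∫ ω in B, f ω ∂P = 0)
    {B : Set Ω} (hB : MeasurableSet[m₁] B) : ∫ ω in B, f ω ∂P = 0 := by
  induction B, hB using MeasurableSpace.induction_on_inter hT hpi with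
  | empty => simp
  | basic B hB => exact hfT B hB
  | compl B hB ih => rw [setIntegral_compl (hm₁ _ hB) hf, huniv, ih, sub_zero]
  | iUnion B hd hB ih =>
    rw [integral_iUnion (fun i => hm₁ _ (hB i)) hd hf.integrableOn]
    simp [ih]

lemma aestronglyMeasurable_apply_min_argmax
    (hM : StronglyAdapted ℱ M) (hMc : ∀ ω, Continuous fun t => M t ω)
    (hM0 : ∀ᵐ ω ∂P, M 0 ω = 1) (hMlim : ∀ᵐ ω ∂P, Tendsto (fun t => M t ω) atTop (nhds 0))
    (hS : StronglyAdapted ℱ S) (hSc : ∀ ω, Continuous fun t => S t ω) (u : ℝ≥0) :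
    AEStronglyMeasurable[(ℱ u : MeasurableSpace Ω) ⊔
      MeasurableSpace.comap (fun ω => ⨆ v, M v ω) Real.measurableSpace]
      (fun ω => S (min (sInf {r : ℝ≥0 | M r ω = ⨆ v, M v ω}) u) ω) P := by
  refine ⟨fun ω => limsup (fun n => S (lastLevelTime M 1 n u ω) ω) atTop,
    (Measurable.limsup fun n =>
      measurable_apply_lastLevelTime hM hMc hS hSc 1 n u).stronglyMeasurable, ?_⟩
  filter_upwards [hM0, hMlim] with ω h0 hl
  exact (((hSc ω).tendsto _).comp
    (tendsto_lastLevelTime (hMc ω) h0 hl (one_le_iSup (hMc ω) h0 hl) u)).limsup_eq.symm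

variable [IsProbabilityMeasure P]

/-- Between the levels `b + k / (n + 1)` and `b + (k + 1) / (n + 1)` of the overall maximum,
`lastLevelTime` is a fixed hitting time, so this is a sum of differences of hitting-time
identities. -/
lemma setIntegral_apply_lastLevelTime_eq
    (hM : Martingale M ℱ P) (hM_nonneg : ∀ t ω, 0 ≤ M t ω)
    (hMc : ∀ ω, Continuous fun t => M t ω) (hM0 : ∀ᵐ ω ∂P, M 0 ω = 1)
    (hMlim : ∀ᵐ ω ∂P, Tendsto (fun t => M t ω) atTop (nhds 0))
    (hS_bdd : ∀ t ω, |S t ω| ≤ C) (hS : StronglyAdapted ℱ S)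
    (hSc : ∀ ω, Continuous fun t => S t ω) (hMS : Martingale (fun t ω => M t ω * S t ω) ℱ P)
    (hb : 1 ≤ b) (hst : s ≤ t) {A : Set Ω} (hA : MeasurableSet[ℱ s] A) (n : ℕ) :
    ∫ ω in A ∩ {ω | b ≤ ⨆ v, M v ω},
      (S (lastLevelTime M b n t ω) ω - S (lastLevelTime M b n s ω) ω) ∂P = 0 := by
  have hsup := measurable_iSup_apply hM.1 hMc
  have hint (u : ℝ≥0) : Integrable (fun ω => S (lastLevelTime M b n u ω) ω) P :=
    .of_bound ((measurable_apply_lastLevelTime hM.1 hMc hS hSc b n u).mono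
      (sup_comap_iSup_le hM.1 hMc u) le_rfl).aestronglyMeasurable C (.of_forall fun _ => hS_bdd _ _)
  have hint' (x : ℝ) (u : ℝ≥0) : Integrable (fun ω => S (hitTime M x u ω) ω) P :=
    .of_bound ((measurable_stoppedValue (hS.isStronglyProgressive_of_continuous hSc)
      (isStoppingTime_hitTime hM.1 hMc x u)).mono
      (IsStoppingTime.measurableSpace_le _) le_rfl).aestronglyMeasurable C
      (.of_forall fun _ => hS_bdd _ _)
  have hsub {f g : Ω → ℝ} {B : Set Ω} (hf : Integrable f P) (hg : Integrable g P) :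
      IntegrableOn (fun ω => f ω - g ω) B P := (hf.sub hg).integrableOn
  have hA' := ℱ.le s _ hA
  have hE := measurableSet_exists_le_apply hM.1 hMc
  set Q : ℕ → Set Ω := fun k => A ∩ {ω | b ≤ (⨆ v, M v ω) ∧ levelIndex M b n ω = k} with hQ_def
  have hQm (k : ℕ) : MeasurableSet (Q k) :=
    hA'.inter ((measurableSet_le measurable_const hsup).inter
      (measurable_levelIndex hsup b n (measurableSet_singleton k)))
  have hQ : A ∩ {ω | b ≤ ⨆ v, M v ω} = ⋃ k, Q k := by
    ext ω
    simp [hQ_def]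
  rw [hQ, integral_iUnion hQm (fun i j hij => disjoint_left.2 fun ω hi hj =>
    hij (hi.2.2.symm.trans hj.2.2)) (hsub (hint t) (hint s))]
  refine (tsum_congr fun k => ?_).trans tsum_zero
  set x : ℝ := b + k / (n + 1) with hx
  set y : ℝ := b + ((k + 1 : ℕ) : ℝ) / (n + 1) with hy
  have hxy : x ≤ y := by
    rw [hx, hy]
    gcongr
    simp
  have hx1 : 1 ≤ x := hb.trans (le_add_of_nonneg_right (by positivity))
  have hanti : A ∩ {ω | ∃ r, y ≤ M r ω} ⊆ A ∩ {ω | ∃ r, x ≤ M r ω} :=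
    inter_subset_inter_right _ fun ω h => h.imp fun r hr => hxy.trans hr
  have hae : Q k =ᵐ[P]
      ((A ∩ {ω | ∃ r, x ≤ M r ω}) \ (A ∩ {ω | ∃ r, y ≤ M r ω}) : Set Ω) := by
    filter_upwards [hM0, hMlim] with ω h0 hl
    have hx' := exists_le_iff_le_iSup (hMc ω) h0 hl x
    have hy' := exists_le_iff_le_iSup (hMc ω) h0 hl y
    have hk := le_add_div_floor_iff (a := ⨆ v, M v ω) (b := b) n k
    refine propext ?_
    change (ω ∈ A ∧ (b ≤ (⨆ v, M v ω) ∧ levelIndex M b n ω = k)) ↔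
      ((ω ∈ A ∧ ∃ r, x ≤ M r ω) ∧ ¬ (ω ∈ A ∧ ∃ r, y ≤ M r ω))
    rw [hx', hy', levelIndex, hk, ← hx, ← hy, ← not_le]
    tauto
  calc _ = ∫ ω in Q k, (S (hitTime M x t ω) ω - S (hitTime M x s ω) ω) ∂P := by
        refine setIntegral_congr_fun (hQm k) fun ω hω => ?_
        simp only [lastLevelTime, hω.2.2, hx]
    _ = 0 := by
      rw [setIntegral_congr_set hae, setIntegral_sdiff (hA'.inter (hE y))
        (hsub (hint' x t) (hint' x s))
        hanti,
        setIntegral_apply_hitTime_eq hM hM_nonneg hMc hM0 hMlim hS_bdd hS hSc hMS hx1 le_rfl hst hA,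
        setIntegral_apply_hitTime_eq hM hM_nonneg hMc hM0 hMlim hS_bdd hS hSc hMS (hx1.trans hxy)
          hxy hst hA, sub_zero]

lemma integrable_apply_min_argmax
    (hM : StronglyAdapted ℱ M) (hMc : ∀ ω, Continuous fun t => M t ω)
    (hM0 : ∀ᵐ ω ∂P, M 0 ω = 1) (hMlim : ∀ᵐ ω ∂P, Tendsto (fun t => M t ω) atTop (nhds 0))
    (hS_bdd : ∀ t ω, |S t ω| ≤ C)
    (hS : StronglyAdapted ℱ S) (hSc : ∀ ω, Continuous fun t => S t ω) (u : ℝ≥0) :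
    Integrable (fun ω => S (min (sInf {r : ℝ≥0 | M r ω = ⨆ v, M v ω}) u) ω) P :=
  .of_bound ((aestronglyMeasurable_apply_min_argmax hM hMc hM0 hMlim hS hSc u).mono
    (sup_comap_iSup_le hM hMc u)) C (.of_forall fun _ => hS_bdd _ _)

lemma setIntegral_apply_min_argmax_eq
    (hM : Martingale M ℱ P) (hM_nonneg : ∀ t ω, 0 ≤ M t ω)
    (hMc : ∀ ω, Continuous fun t => M t ω) (hM0 : ∀ᵐ ω ∂P, M 0 ω = 1)
    (hMlim : ∀ᵐ ω ∂P, Tendsto (fun t => M t ω) atTop (nhds 0))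
    (hS_bdd : ∀ t ω, |S t ω| ≤ C) (hS : StronglyAdapted ℱ S)
    (hSc : ∀ ω, Continuous fun t => S t ω) (hMS : Martingale (fun t ω => M t ω * S t ω) ℱ P)
    (hst : s ≤ t) {A : Set Ω} (hA : MeasurableSet[ℱ s] A) (b : ℝ) :
    ∫ ω in A ∩ {ω | b ≤ ⨆ v, M v ω},
      (S (min (sInf {r : ℝ≥0 | M r ω = ⨆ v, M v ω}) t) ω -
        S (min (sInf {r : ℝ≥0 | M r ω = ⨆ v, M v ω}) s) ω) ∂P = 0 := by
  have hsup := measurable_iSup_apply hM.1 hMc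
  have hae : (A ∩ {ω | b ≤ ⨆ v, M v ω} : Set Ω) =ᵐ[P] (A ∩ {ω | max b 1 ≤ ⨆ v, M v ω} : Set Ω) := by
    filter_upwards [hM0, hMlim] with ω h0 hl
    refine propext (and_congr_right fun _ => ?_)
    exact ⟨fun h => max_le h (one_le_iSup (hMc ω) h0 hl), fun h => le_trans (le_max_left b 1) h⟩
  rw [setIntegral_congr_set hae]
  have hmeas (n : ℕ) (u : ℝ≥0) : Measurable fun ω => S (lastLevelTime M (max b 1) n u ω) ω :=
    (measurable_apply_lastLevelTime hM.1 hMc hS hSc _ n u).mono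
      (sup_comap_iSup_le hM.1 hMc u) le_rfl
  have hlim := tendsto_integral_of_dominated_convergence
    (μ := P.restrict (A ∩ {ω | max b 1 ≤ ⨆ v, M v ω}))
    (F := fun n ω => S (lastLevelTime M (max b 1) n t ω) ω - S (lastLevelTime M (max b 1) n s ω) ω)
    (f := fun ω => S (min (sInf {r : ℝ≥0 | M r ω = ⨆ v, M v ω}) t) ω -
        S (min (sInf {r : ℝ≥0 | M r ω = ⨆ v, M v ω}) s) ω) (fun _ => C + C)
    (fun n => ((hmeas n t).sub (hmeas n s)).aestronglyMeasurable) (integrable_const _)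
    (fun n => .of_forall fun _ =>
      (norm_sub_le _ _).trans (add_le_add (hS_bdd _ _) (hS_bdd _ _))) (by
      filter_upwards [ae_restrict_of_ae hM0, ae_restrict_of_ae hMlim,
        ae_restrict_mem ((ℱ.le s _ hA).inter (measurableSet_le measurable_const hsup))]
        with ω h0 hl hω
      have h (u : ℝ≥0) := ((hSc ω).tendsto _).comp (tendsto_lastLevelTime (hMc ω) h0 hl hω.2 u)
      exact (h t).sub (h s))
  simp only [setIntegral_apply_lastLevelTime_eq hM hM_nonneg hMc hM0 hMlim hS_bdd hS hSc hMS
    (le_max_right b 1) hst hA] at hlim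
  exact tendsto_nhds_unique hlim tendsto_const_nhds

end Enlargement

/-- **Theorem 1.1.** Let `M` be a nonnegative continuous martingale with
`M 0 = 1` a.s. and `M t → 0` a.s. as `t → ∞`, and let `ρ := inf {t | M t = M*_∞}` be the
(a.s. unique and a.s. finite) time of the overall maximum of `M`. Let `S` be a bounded
adapted continuous process such that `M * S` is a martingale. With the initially enlarged
σ-algebras `𝓖_s := 𝓕_s ⊔ σ(M*_∞)`, the stopped process `(S_{ρ∧t})` is a martingale with
respect to `(𝓖_t)` and `P`: for all `0 ≤ s ≤ t`, `E[S_{ρ∧t} | 𝓖_s] = S_{ρ∧s}` a.s. -/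
theorem stopped_price_is_martingale_in_enlarged_filtration
    {Ω : Type*} {m : MeasurableSpace Ω} {P : Measure Ω} [IsProbabilityMeasure P]
    (ℱ : Filtration ℝ≥0 m) (M : ℝ≥0 → Ω → ℝ)
    (hMmart : Martingale M ℱ P)
    (hMnonneg : ∀ t ω, 0 ≤ M t ω)
    (hMcont : ∀ ω, Continuous fun t => M t ω)
    (hM0 : ∀ᵐ ω ∂P, M 0 ω = 1)
    (hMlim : ∀ᵐ ω ∂P, Tendsto (fun t => M t ω) atTop (nhds (0 : ℝ)))
    (ρ : Ω → ℝ≥0) (hρ : ∀ ω, ρ ω = sInf {u : ℝ≥0 | M u ω = ⨆ v, M v ω})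
    (S : ℝ≥0 → Ω → ℝ) (C : ℝ) (hSbdd : ∀ t ω, |S t ω| ≤ C)
    (hSadapted : Adapted ℱ S)
    (hScont : ∀ ω, Continuous fun t => S t ω)
    (hMS : Martingale (fun t ω => M t ω * S t ω) ℱ P) :
    ∀ s t : ℝ≥0, s ≤ t →
      P[(fun ω => S (min (ρ ω) t) ω) |
          (ℱ s : MeasurableSpace Ω) ⊔
            MeasurableSpace.comap (fun ω => ⨆ v, M v ω) Real.measurableSpace]
        =ᵐ[P] fun ω => S (min (ρ ω) s) ω := by
  intro s t hst
  obtain rfl : ρ = fun ω => sInf {u : ℝ≥0 | M u ω = ⨆ v, M v ω} := funext hρ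
  have hS := hSadapted.stronglyAdapted
  have hint := integrable_apply_min_argmax hMmart.1 hMcont hM0 hMlim hSbdd hS hScont
  have hle := sup_comap_iSup_le hMmart.1 hMcont s
  have hzero {A : Set Ω} (hA : MeasurableSet[ℱ s] A) (b : ℝ) :=
    setIntegral_apply_min_argmax_eq hMmart hMnonneg hMcont hM0 hMlim hSbdd hS hScont hMS hst hA b
  have hsup_nonneg (ω : Ω) : 0 ≤ ⨆ v, M v ω := Real.iSup_nonneg fun v => hMnonneg v ω
  refine (ae_eq_condExp_of_forall_setIntegral_eq hle (hint t) (fun _ _ _ => (hint s).integrableOn)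
    (fun B hB _ => ?_)
    (aestronglyMeasurable_apply_min_argmax hMmart.1 hMcont hM0 hMlim hS hScont s)).symm
  rw [eq_comm, ← sub_eq_zero, ← integral_sub (hint t).integrableOn (hint s).integrableOn]
  refine setIntegral_eq_zero_of_isPiSystem hle ((hint t).sub (hint s))
    (sup_comap_eq_generateFrom hsup_nonneg) isPiSystem_inter_le ?_ ?_ hB
  · simpa [hsup_nonneg] using hzero .univ 0
  · rintro _ ⟨A, b, hA, rfl⟩
    exact hzero hA b
end
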